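/- Let u be the solution of the interior problem with parameters d > 0 and c ∈ ℝ. Assume that |Du| = d at every point of ∂Ω and that sup_{∂Ω} H/(n−1) ≥ ( |𝕊^{n−1}|/|∂Ω| )^{1/(n−1)}. Then there exists r₀ > 0 such that Ω = B(0, r₀) and u(x) = c + (d|∂Ω|/((n−2)|𝕊^{n−1}|)) ( |x|^{2−n} − r₀^{2−n} ) for all x ∈ Ω∖{0}; in particular u is rotationally symmetric. -/

import Mathlib

open MeasureTheory Metric Set Filter
open scoped Topology ENNReal NNReal InnerProductSpace

noncomputable section

/-- Hessian of `u` at `x`, evaluated on the pair of vectors `(v, w)`. -/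
def hess2 {n : ℕ} (u : EuclideanSpace ℝ (Fin n) → ℝ) (x v w : EuclideanSpace ℝ (Fin n)) : ℝ :=
  iteratedFDeriv ℝ 2 u x ![v, w]

/-- Laplacian of `u` at `x`. -/
def lap {n : ℕ} (u : EuclideanSpace ℝ (Fin n) → ℝ) (x : EuclideanSpace ℝ (Fin n)) : ℝ :=
  ∑ i : Fin n, hess2 u x (EuclideanSpace.single i 1) (EuclideanSpace.single i 1)

/-- Mean curvature at `x` of the level set of `u` through `x`, with respect to the unit
normal `ν = -Du/|Du|`:  `H = D²u(ν,ν)/|Du|` (valid for harmonic `u`). -/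
def meanH {n : ℕ} (u : EuclideanSpace ℝ (Fin n) → ℝ) (x : EuclideanSpace ℝ (Fin n)) : ℝ :=
  hess2 u x (gradient u x) (gradient u x) / ‖gradient u x‖ ^ 3

/-- `(n-1)`-dimensional Hausdorff measure (area) of a subset of `ℝⁿ`. -/
def sArea {n : ℕ} (s : Set (EuclideanSpace ℝ (Fin n))) : ℝ :=
  (μH[(n : ℝ) - 1] s).toReal

/-- Area of the unit sphere `𝕊^{n-1} ⊆ ℝⁿ`. -/
def sphereArea (n : ℕ) : ℝ := sArea (Metric.sphere (0 : EuclideanSpace ℝ (Fin n)) 1)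

/-- `Ω` is a bounded domain containing the origin. -/
def GoodDomain {n : ℕ} (Ω : Set (EuclideanSpace ℝ (Fin n))) : Prop :=
  IsOpen Ω ∧ IsConnected Ω ∧ Bornology.IsBounded Ω ∧ (0 : EuclideanSpace ℝ (Fin n)) ∈ Ω

/-- The exterior problem: `u` is smooth up to the boundary on `ℝⁿ∖Ω`, harmonic in
`ℝⁿ∖closure(Ω)`, equal to `1` on `∂Ω`, and tends to `0` at infinity. -/
def ExteriorSol {n : ℕ} (Ω : Set (EuclideanSpace ℝ (Fin n)))
    (u : EuclideanSpace ℝ (Fin n) → ℝ) : Prop :=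
  (∃ U, IsOpen U ∧ Ωᶜ ⊆ U ∧ ContDiffOn ℝ (⊤ : ℕ∞) u U) ∧
  (∀ x ∈ (closure Ω)ᶜ, lap u x = 0) ∧
  (∀ x ∈ frontier Ω, u x = 1) ∧
  Tendsto u (cocompact (EuclideanSpace ℝ (Fin n))) (nhds 0)

/-- The interior problem with parameters `d > 0` and `c`: `u` is smooth up to the boundary away
from the origin, harmonic in `Ω∖{0}`, equal to `c` on `∂Ω`, and
`u - d|∂Ω||x|^{2-n}/((n-2)|𝕊^{n-1}|)` extends to a harmonic function on `Ω`. -/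
def InteriorSol {n : ℕ} (Ω : Set (EuclideanSpace ℝ (Fin n))) (d c : ℝ)
    (u : EuclideanSpace ℝ (Fin n) → ℝ) : Prop :=
  (∃ U, IsOpen U ∧ closure Ω ⊆ U ∧ ContDiffOn ℝ (⊤ : ℕ∞) u (U \ {0})) ∧
  (∀ x ∈ Ω \ {(0 : EuclideanSpace ℝ (Fin n))}, lap u x = 0) ∧
  (∀ x ∈ frontier Ω, u x = c) ∧
  (∃ v : EuclideanSpace ℝ (Fin n) → ℝ, ContDiffOn ℝ (⊤ : ℕ∞) v Ω ∧ (∀ x ∈ Ω, lap v x = 0) ∧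
    ∀ x ∈ Ω \ {(0 : EuclideanSpace ℝ (Fin n))},
      u x = d * sArea (frontier Ω) / (((n : ℝ) - 2) * sphereArea n) * ‖x‖ ^ ((2 : ℝ) - n) + v x)

/-- The `P`-function `|Du|²/u^{2(n-1)/(n-2)} = |∇f|_g²`. -/
def Pfun {n : ℕ} (u : EuclideanSpace ℝ (Fin n) → ℝ) (x : EuclideanSpace ℝ (Fin n)) : ℝ :=
  ‖gradient u x‖ ^ 2 / u x ^ (2 * ((n : ℝ) - 1) / ((n : ℝ) - 2))

/-- `|∇f|_g = |Du|/u^{(n-1)/(n-2)}`, the `g`-length of the gradient of `f = log u`. -/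
def gradg {n : ℕ} (u : EuclideanSpace ℝ (Fin n) → ℝ) (x : EuclideanSpace ℝ (Fin n)) : ℝ :=
  ‖gradient u x‖ / u x ^ (((n : ℝ) - 1) / ((n : ℝ) - 2))

/-- The tensor `T = D²f - (1/(n-2))(2 df⊗df - |Df|² Id)` for `f = log u`, evaluated on `(v,w)`. -/
def Tlog {n : ℕ} (u : EuclideanSpace ℝ (Fin n) → ℝ) (x v w : EuclideanSpace ℝ (Fin n)) : ℝ :=
  hess2 (fun y => Real.log (u y)) x v w -
    (1 / ((n : ℝ) - 2)) *
      (2 * ⟪gradient (fun y => Real.log (u y)) x, v⟫_ℝ *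
          ⟪gradient (fun y => Real.log (u y)) x, w⟫_ℝ -
        ‖gradient (fun y => Real.log (u y)) x‖ ^ 2 * ⟪v, w⟫_ℝ)

/-- `|∇²f|_g² = u^{-4/(n-2)} |T|²`, the squared `g`-norm of the `g`-Hessian of `f = log u`. -/
def hessgSq {n : ℕ} (u : EuclideanSpace ℝ (Fin n) → ℝ) (x : EuclideanSpace ℝ (Fin n)) : ℝ :=
  u x ^ (-(4 : ℝ) / ((n : ℝ) - 2)) *
    ∑ i : Fin n, ∑ j : Fin n,
      (Tlog u x (EuclideanSpace.single i 1) (EuclideanSpace.single j 1)) ^ 2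

/-- The `g`-mean curvature of a regular level set of `u`:
`H_g/(n-1) = u^{-1/(n-2)} ( H/(n-1) - |Du|/((n-2)u) )`. -/
def Hg {n : ℕ} (u : EuclideanSpace ℝ (Fin n) → ℝ) (x : EuclideanSpace ℝ (Fin n)) : ℝ :=
  ((n : ℝ) - 1) * u x ^ (-(1 : ℝ) / ((n : ℝ) - 2)) *
    (meanH u x / ((n : ℝ) - 1) - ‖gradient u x‖ / (((n : ℝ) - 2) * u x))

/-- The pointwise Hessian identity `u·D²u = (n/(n-2)) Du⊗Du - (|Du|²/(n-2)) Id`, equivalent to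
the vanishing of the `g`-Hessian of `f = log u`. -/
def HessId {n : ℕ} (u : EuclideanSpace ℝ (Fin n) → ℝ) (x : EuclideanSpace ℝ (Fin n)) : Prop :=
  ∀ v w : EuclideanSpace ℝ (Fin n),
    u x * hess2 u x v w =
      ((n : ℝ) / ((n : ℝ) - 2)) * (⟪gradient u x, v⟫_ℝ * ⟪gradient u x, w⟫_ℝ) -
        (‖gradient u x‖ ^ 2 / ((n : ℝ) - 2)) * ⟪v, w⟫_ℝ

/-- Euclidean space of dimension `n`. -/
abbrev Euc (n : ℕ) := EuclideanSpace ℝ (Fin n)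

section PartialDerivatives

variable {n : ℕ}

/-- The `i`-th partial derivative of `f` at `x`. -/
def pd (i : Fin n) (f : Euc n → ℝ) (x : Euc n) : ℝ := fderiv ℝ f x (EuclideanSpace.single i 1)

theorem hasDerivAt_pd {f : Euc n → ℝ} {x : Euc n} (i : Fin n) (hf : DifferentiableAt ℝ f x) :
    HasDerivAt (fun t : ℝ => f (x + t • EuclideanSpace.single i 1)) (pd i f x) 0 :=
  hf.hasFDerivAt.hasLineDerivAt _

theorem pd_congr {f g : Euc n → ℝ} {x : Euc n} (i : Fin n) (h : f =ᶠ[𝓝 x] g) :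
    pd i f x = pd i g x := by
  unfold pd
  rw [h.fderiv_eq]

theorem fderiv_eq_sum_pd (f : Euc n → ℝ) (x v : Euc n) :
    fderiv ℝ f x v = ∑ i, v i * pd i f x := by
  have h : v = ∑ i, v i • (EuclideanSpace.single i 1 : Euc n) := by
    ext j
    simp [Pi.single_apply]
  conv_lhs => rw [h]
  simp [pd]

theorem inner_gradient_eq_fderiv (f : Euc n → ℝ) (x v : Euc n) :
    ⟪gradient f x, v⟫_ℝ = fderiv ℝ f x v := by
  simp [gradient]

theorem gradient_apply (f : Euc n → ℝ) (x : Euc n) (i : Fin n) : gradient f x i = pd i f x := by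
  have h := inner_gradient_eq_fderiv f x (EuclideanSpace.single i 1)
  rw [EuclideanSpace.inner_single_right] at h
  simpa [pd] using h

theorem norm_gradient_sq (f : Euc n → ℝ) (x : Euc n) :
    ‖gradient f x‖ ^ 2 = ∑ i, pd i f x ^ 2 := by
  simp [EuclideanSpace.norm_sq_eq, gradient_apply]

theorem ContDiffOn.pd {f : Euc n → ℝ} {s : Set (Euc n)} {k m : WithTop ℕ∞}
    (hf : ContDiffOn ℝ k f s) (hs : IsOpen s) (hkm : m + 1 ≤ k) (i : Fin n) :
    ContDiffOn ℝ m (pd i f) s :=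
  (hf.fderiv_of_isOpen hs hkm).clm_apply contDiffOn_const

theorem ContDiffAt.pd {f : Euc n → ℝ} {x : Euc n} {k m : WithTop ℕ∞}
    (hf : ContDiffAt ℝ k f x) (hkm : m + 1 ≤ k) (i : Fin n) : ContDiffAt ℝ m (pd i f) x :=
  (hf.fderiv_right hkm).clm_apply contDiffAt_const

theorem hess2_eq_fderiv (f : Euc n → ℝ) (x v w : Euc n) :
    hess2 f x v w = fderiv ℝ (fderiv ℝ f) x v w := by
  simp [hess2, iteratedFDeriv_two_apply]

theorem pd_pd_eq {f : Euc n → ℝ} {x : Euc n} (hf : ContDiffAt ℝ 2 f x) (i j : Fin n) :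
    pd i (pd j f) x =
      fderiv ℝ (fderiv ℝ f) x (EuclideanSpace.single i 1) (EuclideanSpace.single j 1) := by
  have h : DifferentiableAt ℝ (fderiv ℝ f) x :=
    (hf.fderiv_right (m := 1) (by norm_num)).differentiableAt (by norm_num)
  unfold pd
  rw [fderiv_clm_apply h (differentiableAt_const _)]
  simp

theorem pd_comm {f : Euc n → ℝ} {x : Euc n} (hf : ContDiffAt ℝ 2 f x) (i j : Fin n) :
    pd i (pd j f) x = pd j (pd i f) x := by
  rw [pd_pd_eq hf, pd_pd_eq hf]
  exact (hf.isSymmSndFDerivAt (by simp)).eq _ _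

theorem lap_eq_sum_pd {f : Euc n → ℝ} {x : Euc n} (hf : ContDiffAt ℝ 2 f x) :
    lap f x = ∑ i, pd i (pd i f) x := by
  simp [lap, hess2_eq_fderiv, pd_pd_eq hf]

theorem hess2_gradient {f : Euc n → ℝ} {x : Euc n} (hf : ContDiffAt ℝ 2 f x) :
    hess2 f x (gradient f x) (gradient f x) =
      ∑ i, ∑ j, pd i f x * pd j f x * pd i (pd j f) x := by
  have h : gradient f x = ∑ i, pd i f x • (EuclideanSpace.single i 1 : Euc n) := by
    ext j
    simp [Pi.single_apply, gradient_apply]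
  rw [hess2_eq_fderiv, h]
  simp only [map_sum, map_smul, sum_apply, smul_apply,
    ← pd_pd_eq hf, smul_eq_mul, Finset.mul_sum]
  rw [Finset.sum_comm]
  refine Finset.sum_congr rfl fun i _ => Finset.sum_congr rfl fun j _ => ?_
  ring

theorem pd_add {f g : Euc n → ℝ} {x : Euc n} (i : Fin n) (hf : DifferentiableAt ℝ f x)
    (hg : DifferentiableAt ℝ g x) : pd i (fun y => f y + g y) x = pd i f x + pd i g x := by
  simp [pd, fderiv_fun_add hf hg]

theorem pd_const_mul {f : Euc n → ℝ} {x : Euc n} (i : Fin n) (c : ℝ)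
    (hf : DifferentiableAt ℝ f x) : pd i (fun y => c * f y) x = c * pd i f x := by
  simp [pd, fderiv_const_mul hf c]

theorem IsLocalMax.pd_eq_zero {f : Euc n → ℝ} {x : Euc n} (h : IsLocalMax f x) (i : Fin n) :
    pd i f x = 0 := by
  simp [pd, h.fderiv_eq_zero]

theorem IsLocalMax.pd_pd_nonpos {f : Euc n → ℝ} {x : Euc n} (h : IsLocalMax f x)
    (hf : ContDiffAt ℝ 2 f x) (i : Fin n) : pd i (pd i f) x ≤ 0 := by
  by_contra! hpos
  set e : Euc n := EuclideanSpace.single i 1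
  set g : ℝ → ℝ := fun t => f (x + t • e) with hg
  have hline : ContinuousAt (fun t : ℝ => x + t • e) 0 := by fun_prop
  have hline' : Tendsto (fun t : ℝ => x + t • e) (𝓝 0) (𝓝 x) := by
    simpa using hline.tendsto
  have hdiff : ∀ᶠ y in 𝓝 x, DifferentiableAt ℝ f y :=
    (hf.eventually (by simp)).mono fun y hy => hy.differentiableAt (by norm_num)
  have hderiv : deriv g =ᶠ[𝓝 0] fun t => pd i f (x + t • e) := by
    filter_upwards [hline'.eventually hdiff] with t ht
    have h1 := hasDerivAt_pd i ht
    have h2 : HasDerivAt g (pd i f (x + t • e)) t := by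
      have h3 : HasDerivAt (fun s : ℝ => f (x + t • e + s • e)) (pd i f (x + t • e)) (t - t) := by
        simpa using h1
      have h5 : g = fun s => f (x + t • e + (s - t) • e) := by
        ext s
        simp only [hg]
        congr 1
        module
      rw [h5]
      exact h3.comp_sub_const t t
    exact h2.deriv
  have hd2 : deriv (deriv g) 0 = pd i (pd i f) x := by
    rw [hderiv.deriv_eq]
    exact (hasDerivAt_pd i ((hf.pd (m := 1) (by norm_num) i).differentiableAt
      (by norm_num))).deriv
  have hd1 : deriv g 0 = 0 := by
    rw [hderiv.eq_of_nhds]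
    simpa using h.pd_eq_zero i
  have hmin : IsLocalMin g 0 := by
    refine isLocalMin_of_deriv_deriv_pos (by rw [hd2]; exact hpos) hd1 ?_
    have : ContinuousAt f (x + (0 : ℝ) • e) := by simpa using hf.continuousAt
    exact ContinuousAt.comp (f := fun t : ℝ => x + t • e) this hline
  have hmax : IsLocalMax g 0 := by
    have : ∀ᶠ t in 𝓝 (0 : ℝ), f (x + t • e) ≤ f x := hline'.eventually h
    filter_upwards [this] with t ht
    simpa [hg] using ht
  have hconst : g =ᶠ[𝓝 0] fun _ => g 0 := by
    filter_upwards [hmin, hmax] with t h1 h2 using le_antisymm h2 h1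
  have h0 : deriv (deriv g) 0 = 0 := by
    have h1 : deriv g =ᶠ[𝓝 0] fun _ => 0 := by
      filter_upwards [hconst.eventually_nhds] with t ht
      rw [Filter.EventuallyEq.deriv_eq ht]
      simp
    rw [h1.deriv_eq]
    simp
  linarith

end PartialDerivatives

section MaximumPrinciple

variable {n : ℕ}

/-- The elliptic operator `Δ + b · D`. -/
def driftLap (b : Euc n → Euc n) (f : Euc n → ℝ) (x : Euc n) : ℝ :=
  ∑ i, pd i (pd i f) x + ∑ i, b x i * pd i f x

theorem IsLocalMax.driftLap_nonpos {b : Euc n → Euc n} {f : Euc n → ℝ} {x : Euc n}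
    (h : IsLocalMax f x) (hf : ContDiffAt ℝ 2 f x) : driftLap b f x ≤ 0 := by
  have h1 : ∑ i, pd i (pd i f) x ≤ 0 := Finset.sum_nonpos fun i _ => h.pd_pd_nonpos hf i
  simpa [driftLap, h.pd_eq_zero] using h1

theorem driftLap_add_const_mul {b : Euc n → Euc n} {f g : Euc n → ℝ} {x : Euc n} (c : ℝ)
    (hf : ContDiffAt ℝ 2 f x) (hg : ContDiffAt ℝ 2 g x) :
    driftLap b (fun y => f y + c * g y) x = driftLap b f x + c * driftLap b g x := by
  have h1 : ∀ y, ContDiffAt ℝ 2 f y → ContDiffAt ℝ 2 g y → ∀ i,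
      pd i (fun y => f y + c * g y) y = pd i f y + c * pd i g y := by
    intro y hfy hgy i
    have hd := hgy.differentiableAt (by norm_num)
    rw [pd_add i (hfy.differentiableAt (by norm_num)) (hd.const_mul c), pd_const_mul i c hd]
  have h2 : ∀ i, pd i (pd i (fun y => f y + c * g y)) x =
      pd i (pd i f) x + c * pd i (pd i g) x := by
    intro i
    have hev : pd i (fun y => f y + c * g y) =ᶠ[𝓝 x] fun y => pd i f y + c * pd i g y := by
      filter_upwards [hf.eventually (by norm_num), hg.eventually (by norm_num)] with y h3 h4
      exact h1 y h3 h4 i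
    have hd := (hg.pd (m := 1) (by norm_num) i).differentiableAt (by norm_num)
    rw [pd_congr i hev, pd_add i ((hf.pd (m := 1) (by norm_num) i).differentiableAt
      (by norm_num)) (hd.const_mul c), pd_const_mul i c hd]
  simp only [driftLap, h1 x hf hg, h2, Finset.sum_add_distrib, mul_add, Finset.mul_sum]
  have h3 : ∀ i, b x i * (c * pd i g x) = c * (b x i * pd i g x) := fun i => by ring
  simp only [h3]
  ring

theorem contDiff_gaussian (α : ℝ) (y : Euc n) :
    ContDiff ℝ 2 fun x : Euc n => Real.exp (-α * ‖x - y‖ ^ 2) :=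
  (contDiff_const.mul ((contDiff_id.sub contDiff_const).norm_sq ℝ)).exp

theorem hasFDerivAt_gaussian (α : ℝ) (x y : Euc n) :
    HasFDerivAt (fun x : Euc n => Real.exp (-α * ‖x - y‖ ^ 2))
      ((-2 * α * Real.exp (-α * ‖x - y‖ ^ 2)) • innerSL ℝ (x - y)) x := by
  have h := ((((hasFDerivAt_id x).sub_const y).norm_sq).const_mul (-α)).exp
  refine h.congr_fderiv ?_
  ext v
  simp
  ring

theorem pd_gaussian (α : ℝ) (y : Euc n) (i : Fin n) :
    pd i (fun x : Euc n => Real.exp (-α * ‖x - y‖ ^ 2)) =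
      fun x => -2 * α * (Real.exp (-α * ‖x - y‖ ^ 2) * (x i - y i)) := by
  ext x
  rw [pd, (hasFDerivAt_gaussian α x y).fderiv]
  simp [EuclideanSpace.inner_single_right]
  ring

theorem pd_pd_gaussian (α : ℝ) (x y : Euc n) (i : Fin n) :
    pd i (pd i (fun x : Euc n => Real.exp (-α * ‖x - y‖ ^ 2))) x =
      Real.exp (-α * ‖x - y‖ ^ 2) * (4 * α ^ 2 * (x i - y i) ^ 2 - 2 * α) := by
  have hp : HasFDerivAt (fun x : Euc n => x i - y i) (EuclideanSpace.proj i : Euc n →L[ℝ] ℝ) x :=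
    ((EuclideanSpace.proj i : Euc n →L[ℝ] ℝ).hasFDerivAt).sub_const (y i)
  rw [pd_gaussian, pd, (((hasFDerivAt_gaussian α x y).fun_mul hp).const_mul (-2 * α)).fderiv]
  simp [EuclideanSpace.inner_single_right]
  ring

theorem driftLap_gaussian (b : Euc n → Euc n) (α : ℝ) (x y : Euc n) :
    driftLap b (fun x : Euc n => Real.exp (-α * ‖x - y‖ ^ 2)) x =
      Real.exp (-α * ‖x - y‖ ^ 2) *
        (4 * α ^ 2 * ‖x - y‖ ^ 2 - 2 * α * n - 2 * α * ⟪b x, x - y⟫_ℝ) := by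
  simp only [driftLap, pd_pd_gaussian]
  simp only [pd_gaussian]
  rw [← Finset.mul_sum, Finset.sum_sub_distrib, ← Finset.mul_sum]
  have h1 : ∑ i, (x i - y i) ^ 2 = ‖x - y‖ ^ 2 := by simp [EuclideanSpace.norm_sq_eq]
  have h2 : ∑ i, b x i * (-2 * α * (Real.exp (-α * ‖x - y‖ ^ 2) * (x i - y i))) =
      -2 * α * Real.exp (-α * ‖x - y‖ ^ 2) * ⟪b x, x - y⟫_ℝ := by
    rw [PiLp.inner_apply, Finset.mul_sum]
    refine Finset.sum_congr rfl fun i _ => ?_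
    simp
    ring
  rw [h1, h2]
  simp
  ring

/-- Hopf's boundary point lemma on a ball. -/
theorem hopf_lemma {f : Euc n → ℝ} {b : Euc n → Euc n} {y x₀ : Euc n} {R M B : ℝ} (hR : 0 < R)
    (hf : ContDiffOn ℝ 2 f (ball y R)) (hc : ContinuousOn f (closedBall y R))
    (hb : ∀ x ∈ ball y R, ‖b x‖ ≤ B) (hL : ∀ x ∈ ball y R, 0 ≤ driftLap b f x)
    (hlt : ∀ x ∈ ball y R, f x < M) (hx₀ : x₀ ∈ sphere y R) (hM : f x₀ = M)
    (hd : DifferentiableAt ℝ f x₀) : 0 < fderiv ℝ f x₀ (x₀ - y) := by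
  have hB : 0 ≤ B := (norm_nonneg _).trans (hb y (mem_ball_self hR))
  have hle : ∀ x ∈ closedBall y R, f x ≤ M := by
    intro x hx
    rw [← closure_ball y hR.ne'] at hx hc
    have h1 : MapsTo f (closure (ball y R)) (closure (Iic M)) :=
      MapsTo.closure_of_continuousOn (fun z hz => (hlt z hz).le) hc
    simpa using h1 hx
  set α : ℝ := (2 * (n + B * R) + 1) / R ^ 2 with hα
  have hαR : α * R ^ 2 = 2 * (n + B * R) + 1 := by rw [hα]; field_simp
  have hα0 : 0 < α := by positivity
  set h : Euc n → ℝ := fun x => Real.exp (-α * ‖x - y‖ ^ 2) with hh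
  have hLh : ∀ x, R / 2 ≤ ‖x - y‖ → x ∈ ball y R → 0 < driftLap b h x := by
    intro x h1 h2
    rw [hh, driftLap_gaussian]
    refine mul_pos (Real.exp_pos _) ?_
    have h3 : ‖x - y‖ < R := by simpa [dist_eq_norm] using h2
    have h4 : ⟪b x, x - y⟫_ℝ ≤ B * R :=
      (real_inner_le_norm _ _).trans (mul_le_mul (hb x h2) h3.le (norm_nonneg _) hB)
    have h5 : R ^ 2 / 4 ≤ ‖x - y‖ ^ 2 := by nlinarith
    have h6 : α * R ^ 2 ≤ α * (4 * ‖x - y‖ ^ 2) := by nlinarith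
    have h7 : 0 < α * (4 * ‖x - y‖ ^ 2) - 2 * n - 2 * ⟪b x, x - y⟫_ℝ := by nlinarith
    nlinarith [mul_pos hα0 h7]
  obtain ⟨z₁, hz₁, hmax₁⟩ := (isCompact_closedBall y (R / 2)).exists_isMaxOn
    ⟨y, mem_closedBall_self (by positivity)⟩
    (hc.mono (closedBall_subset_closedBall (by linarith)))
  have hε : 0 < M - f z₁ := by
    have := hlt z₁ (closedBall_subset_ball (by linarith) hz₁)
    linarith
  set ε : ℝ := M - f z₁ with hεdef
  set h₀ : ℝ := Real.exp (-α * R ^ 2) with hh₀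
  have hh₀pos : 0 < h₀ := Real.exp_pos _
  have hh1 : ∀ x, h x ≤ 1 := by
    intro x
    rw [hh]
    simp only [Real.exp_le_one_iff]
    nlinarith [sq_nonneg ‖x - y‖]
  have hcont : Continuous h := (contDiff_gaussian α y).continuous
  set K : Set (Euc n) := closedBall y R \ ball y (R / 2) with hK
  have hKc : IsCompact K := (isCompact_closedBall y R).diff isOpen_ball
  set F : Euc n → ℝ := fun x => f x + ε * h x with hF
  have hx₀K : x₀ ∈ K := by
    have h1 : dist x₀ y = R := hx₀
    exact ⟨h1.le, by simp only [mem_ball, not_lt]; linarith⟩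
  have hFx₀ : F x₀ = M + ε * h₀ := by
    have h1 : ‖x₀ - y‖ = R := by simpa [dist_eq_norm] using hx₀
    simp [hF, hh, h1, hM, hh₀]
  have hFc : ContinuousOn F K :=
    (hc.mono sdiff_subset).add (continuousOn_const.mul hcont.continuousOn)
  have hmaxK : IsMaxOn F K x₀ := by
    obtain ⟨z, hzK, hz⟩ := hKc.exists_isMaxOn ⟨x₀, hx₀K⟩ hFc
    suffices hFz : F z ≤ F x₀ from fun x hx => (hz hx).trans hFz
    rw [hFx₀]
    have hz1 : ‖z - y‖ ≤ R := by simpa [dist_eq_norm] using hzK.1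
    have hz2 : R / 2 ≤ ‖z - y‖ := by simpa [dist_eq_norm] using hzK.2
    rcases hz1.eq_or_lt with h1 | h1
    · have h2 : h z = h₀ := by simp [hh, h1, hh₀]
      have h3 := hle z hzK.1
      simp only [hF, h2]
      linarith
    rcases hz2.eq_or_lt with h2 | h2
    · have h3 : f z ≤ f z₁ := hmax₁ (by simp [dist_eq_norm, ← h2])
      have h4 := hh1 z
      simp only [hF]
      nlinarith [mul_pos hε hh₀pos]
    · exfalso
      have hzb : z ∈ ball y R := by simpa [dist_eq_norm] using h1
      have hnhds : K ∈ 𝓝 z := by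
        have h3 : ball y R ∩ (closedBall y (R / 2))ᶜ ∈ 𝓝 z :=
          (isOpen_ball.inter isClosed_closedBall.isOpen_compl).mem_nhds
            ⟨hzb, by simpa [dist_eq_norm] using h2⟩
        exact mem_of_superset h3 fun x hx =>
          ⟨ball_subset_closedBall hx.1, fun h4 => hx.2 (ball_subset_closedBall h4)⟩
      have hloc : IsLocalMax F z := hz.isLocalMax hnhds
      have hfz : ContDiffAt ℝ 2 f z := hf.contDiffAt (isOpen_ball.mem_nhds hzb)
      have hhz : ContDiffAt ℝ 2 h z := (contDiff_gaussian α y).contDiffAt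
      have h3 := hloc.driftLap_nonpos (b := b) (hfz.add (contDiffAt_const.mul hhz))
      rw [hF, driftLap_add_const_mul ε hfz hhz] at h3
      have h4 := hL z hzb
      have h5 := mul_pos hε (hLh z hz2 hzb)
      linarith
  have hderiv : HasFDerivAt F (fderiv ℝ f x₀ + ε • ((-2 * α * h x₀) • innerSL ℝ (x₀ - y))) x₀ :=
    hd.hasFDerivAt.add ((hasFDerivAt_gaussian α x₀ y).const_mul ε)
  have hnorm : ‖x₀ - y‖ = R := by simpa [dist_eq_norm] using hx₀
  have hcone : (2 : ℝ)⁻¹ • (y - x₀) ∈ posTangentConeAt K x₀ := by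
    refine mem_posTangentConeAt_of_segment_subset ?_
    rw [segment_eq_image']
    rintro _ ⟨t, ⟨ht0, ht1⟩, rfl⟩
    have h1 : x₀ + t • (x₀ + (2 : ℝ)⁻¹ • (y - x₀) - x₀) - y = (1 - t / 2) • (x₀ - y) := by
      module
    have h2 : dist (x₀ + t • (x₀ + (2 : ℝ)⁻¹ • (y - x₀) - x₀)) y = (1 - t / 2) * R := by
      rw [dist_eq_norm, h1, norm_smul, hnorm, Real.norm_of_nonneg (by linarith)]
    refine ⟨?_, ?_⟩
    · rw [mem_closedBall, h2]
      nlinarith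
    · rw [mem_ball, h2]
      nlinarith
  have hfin := hmaxK.localize.hasFDerivWithinAt_nonpos hderiv.hasFDerivWithinAt hcone
  have hv : (2 : ℝ)⁻¹ • (y - x₀) = (-(2 : ℝ)⁻¹) • (x₀ - y) := by module
  rw [hv, map_smul] at hfin
  simp only [add_apply, smul_apply, innerSL_apply_apply,
    real_inner_self_eq_norm_sq, hnorm, smul_eq_mul] at hfin
  have hpos : 0 < ε * (2 * α * h x₀ * R ^ 2) := by
    have : 0 < h x₀ := Real.exp_pos _
    positivity
  linarith

/-- The strong maximum principle for `Δ + b · D`. -/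
theorem strong_maximum_principle {f : Euc n → ℝ} {b : Euc n → Euc n} {V : Set (Euc n)}
    (hV : IsOpen V) (hVc : IsPreconnected V) (hf : ContDiffOn ℝ 2 f V) (hb : ContinuousOn b V)
    (hL : ∀ x ∈ V, 0 ≤ driftLap b f x) {z : Euc n} (hz : z ∈ V) (hmax : IsMaxOn f V z) :
    ∀ x ∈ V, f x = f z := by
  have hopen : IsOpen {x ∈ V | f x = f z} := by
    rw [Metric.isOpen_iff]
    rintro x ⟨hxV, hxf⟩
    obtain ⟨r, hr, hrV⟩ := Metric.isOpen_iff.1 hV x hxV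
    refine ⟨r / 4, by positivity, fun x₁ hx₁ => ?_⟩
    have hx₁V : x₁ ∈ V := hrV (ball_subset_ball (by linarith) hx₁)
    refine ⟨hx₁V, ?_⟩
    by_contra hne
    have hcV : closedBall x (r / 2) ⊆ V := (closedBall_subset_ball (by linarith)).trans hrV
    have hfc : ContinuousOn f (closedBall x (r / 2)) := hf.continuousOn.mono hcV
    have hS : IsCompact (closedBall x (r / 2) ∩ f ⁻¹' {f z}) :=
      (isCompact_closedBall x (r / 2)).of_isClosed_subset
        (hfc.preimage_isClosed_of_isClosed isClosed_closedBall isClosed_singleton)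
        inter_subset_left
    have hxS : x ∈ closedBall x (r / 2) ∩ f ⁻¹' {f z} :=
      ⟨mem_closedBall_self (by positivity), hxf⟩
    obtain ⟨x₀, hx₀, hmin⟩ := hS.exists_isMinOn ⟨x, hxS⟩
      (continuous_id.dist (continuous_const (y := x₁))).continuousOn
    have hδx : dist x₀ x₁ ≤ dist x x₁ := hmin hxS
    have hxx₁ : dist x₁ x < r / 4 := hx₁
    set δ := dist x₀ x₁ with hδ
    have hδpos : 0 < δ := by
      rw [hδ, dist_pos]
      rintro rfl
      exact hne hx₀.2
    have hball : closedBall x₁ δ ⊆ closedBall x (r / 2) := by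
      refine closedBall_subset_closedBall' ?_
      rw [dist_comm x x₁] at hδx
      linarith
    obtain ⟨B, hB⟩ := (isCompact_closedBall x (r / 2)).exists_bound_of_continuousOn
      (hb.mono hcV)
    have hx₀V : x₀ ∈ V := hcV hx₀.1
    have hpos := hopf_lemma (M := f z) (x₀ := x₀) (b := b) (B := B) hδpos
      (hf.mono ((ball_subset_closedBall.trans hball).trans hcV)) (hfc.mono hball)
      (fun w hw => hB w (hball (ball_subset_closedBall hw)))
      (fun w hw => hL w (hcV (hball (ball_subset_closedBall hw))))
      (fun w hw => by
        have hwc := hball (ball_subset_closedBall hw)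
        refine lt_of_le_of_ne (hmax (hcV hwc)) fun heq => ?_
        have h1 : dist x₀ x₁ ≤ dist w x₁ := hmin ⟨hwc, heq⟩
        have h2 : dist w x₁ < δ := hw
        linarith)
      (mem_sphere.2 hδ.symm) hx₀.2
      ((hf.contDiffAt (hV.mem_nhds hx₀V)).differentiableAt (by norm_num))
    have hloc : IsLocalMax f x₀ := by
      filter_upwards [hV.mem_nhds hx₀V] with w hw
      have h1 : f x₀ = f z := hx₀.2
      rw [h1]
      exact hmax hw
    rw [hloc.fderiv_eq_zero] at hpos
    simp at hpos
  have hopen' : IsOpen {x ∈ V | f x ≠ f z} :=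
    hf.continuousOn.isOpen_inter_preimage hV isOpen_compl_singleton
  intro x hx
  by_contra hne
  obtain ⟨w, -, hw1, hw2⟩ := hVc _ _ hopen hopen'
    (fun y hy => (em (f y = f z)).imp (fun h => ⟨hy, h⟩) fun h => ⟨hy, h⟩)
    ⟨z, hz, hz, rfl⟩ ⟨x, hx, hx, hne⟩
  exact hw2.2 hw1.2

/-- The weak maximum principle for `Δ + b · D`: the condition `f ≤ M` at the boundary is expressed
through compact sets, so that `f` may be singular at some boundary points. -/
theorem weak_maximum_principle {f : Euc n → ℝ} {b : Euc n → Euc n} {V : Set (Euc n)} {M : ℝ}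
    (hV : IsOpen V) (hVc : IsPreconnected V) (hVu : V ≠ univ) (hf : ContDiffOn ℝ 2 f V)
    (hb : ContinuousOn b V) (hL : ∀ x ∈ V, 0 ≤ driftLap b f x)
    (hbd : ∀ m > M, ∃ C, IsCompact C ∧ ContinuousOn f C ∧ ∀ x ∈ (C \ V) ∪ (V \ C), f x < m) :
    ∀ x ∈ V, f x ≤ M := by
  intro z hz
  by_contra! hlt
  obtain ⟨C, hC, hfC, hCV⟩ := hbd (f z) hlt
  have hzC : z ∈ C := by
    by_contra h
    exact lt_irrefl _ (hCV z (Or.inr ⟨hz, h⟩))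
  obtain ⟨w, hwC, hw⟩ := hC.exists_isMaxOn ⟨z, hzC⟩ hfC
  have hzw : f z ≤ f w := hw hzC
  have hwV : w ∈ V := by
    by_contra h
    exact absurd (hCV w (Or.inl ⟨hwC, h⟩)) (not_lt.2 hzw)
  have hmax : IsMaxOn f V w := by
    intro x hx
    by_cases hxC : x ∈ C
    · exact hw hxC
    · exact (hCV x (Or.inr ⟨hx, hxC⟩)).le.trans hzw
  have hconst := strong_maximum_principle hV hVc hf hb hL hwV hmax
  have hsub : V ⊆ C := by
    intro x hx
    by_contra h
    have h1 := hCV x (Or.inr ⟨hx, h⟩)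
    rw [hconst x hx] at h1
    linarith
  have hclC : closure V ⊆ C := closure_minimal hsub hC.isClosed
  have hclV : closure V ⊆ V := by
    intro x hx
    by_contra h
    have h1 := hCV x (Or.inl ⟨hclC hx, h⟩)
    have h2 : MapsTo f (closure V) (closure {f w}) :=
      MapsTo.closure_of_continuousOn (fun y hy => hconst y hy) (hfC.mono hclC)
    have h3 : f x = f w := by simpa using h2 hx
    linarith
  have hclopen : IsClopen V := ⟨closure_subset_iff_isClosed.1 hclV, hV⟩
  rcases isClopen_iff.1 hclopen with h | h
  · simp [h] at hz
  · exact hVu h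

end MaximumPrinciple

section PFunction

variable {n : ℕ}

theorem pd_mul {f g : Euc n → ℝ} {x : Euc n} (i : Fin n) (hf : DifferentiableAt ℝ f x)
    (hg : DifferentiableAt ℝ g x) :
    pd i (fun y => f y * g y) x = pd i f x * g x + f x * pd i g x := by
  simp only [pd, fderiv_fun_mul hf hg, add_apply, smul_apply, smul_eq_mul]
  ring

theorem pd_rpow {f : Euc n → ℝ} {x : Euc n} (i : Fin n) (s : ℝ) (hf : DifferentiableAt ℝ f x)
    (hx : f x ≠ 0) : pd i (fun y => f y ^ s) x = s * f x ^ (s - 1) * pd i f x := by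
  rw [pd, (hf.hasFDerivAt.rpow_const (p := s) (Or.inl hx)).fderiv]
  simp [pd]

theorem pd_sum {ι : Type*} {t : Finset ι} {f : ι → Euc n → ℝ} {x : Euc n} (i : Fin n)
    (hf : ∀ j ∈ t, DifferentiableAt ℝ (f j) x) :
    pd i (fun y => ∑ j ∈ t, f j y) x = ∑ j ∈ t, pd i (f j) x := by
  simp [pd, fderiv_fun_sum hf]

theorem Pfun_eq_mul_rpow {w : Euc n → ℝ} {x : Euc n} (hx : 0 < w x) :
    Pfun w x = (∑ j, pd j w x * pd j w x) * w x ^ (-(2 * ((n : ℝ) - 1) / ((n : ℝ) - 2))) := by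
  rw [Pfun, norm_gradient_sq, Real.rpow_neg hx.le, div_eq_mul_inv]
  simp [sq]

/-- The tensor `w D²w - (n/(n-2)) Dw ⊗ Dw + (|Dw|²/(n-2)) Id` in coordinates. -/
def conformalHess (w : Euc n → ℝ) (x : Euc n) (i j : Fin n) : ℝ :=
  w x * pd i (pd j w) x - (n : ℝ) / ((n : ℝ) - 2) * (pd i w x * pd j w x) +
    (∑ k, pd k w x * pd k w x) / ((n : ℝ) - 2) * if i = j then 1 else 0

theorem sum_sq_of_trace_eq_zero (H : Fin n → Fin n → ℝ) (a : Fin n → ℝ) (W k G m : ℝ)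
    (htr : ∑ i, H i i = 0) (hG : ∑ i, a i * a i = G) :
    ∑ i, ∑ j, (W * H i j - k * (a i * a j) + m * if i = j then 1 else 0) ^ 2 =
      W ^ 2 * ∑ i, ∑ j, H i j ^ 2 + k ^ 2 * G ^ 2 + n * m ^ 2 -
        2 * W * k * ∑ i, ∑ j, a i * a j * H i j - 2 * k * m * G := by
  have h1 : ∀ i j, (W * H i j - k * (a i * a j) + m * if i = j then 1 else 0) ^ 2 =
      W ^ 2 * H i j ^ 2 + k ^ 2 * ((a i * a i) * (a j * a j)) - 2 * W * k * (a i * a j * H i j) +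
        if i = j then m ^ 2 + 2 * m * W * H i i - 2 * m * k * (a i * a i) else 0 := by
    intro i j
    split_ifs with h
    · subst h
      ring
    · ring
  simp only [h1, Finset.sum_add_distrib, Finset.sum_sub_distrib, ← Finset.mul_sum,
    Finset.sum_ite_eq, Finset.mem_univ, if_true, htr, hG, ← Finset.sum_mul]
  simp
  ring

variable {w : Euc n → ℝ} {V : Set (Euc n)}

theorem pd_Pfun (hV : IsOpen V) (hw : ContDiffOn ℝ (⊤ : ℕ∞) w V) (hpos : ∀ x ∈ V, 0 < w x)
    {x : Euc n} (hx : x ∈ V) (i : Fin n) :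
    pd i (Pfun w) x =
      (∑ j, 2 * (pd j w x * pd i (pd j w) x)) * w x ^ (-(2 * ((n : ℝ) - 1) / ((n : ℝ) - 2))) +
      (∑ j, pd j w x * pd j w x) * (-(2 * ((n : ℝ) - 1) / ((n : ℝ) - 2)) *
        w x ^ (-(2 * ((n : ℝ) - 1) / ((n : ℝ) - 2)) - 1) * pd i w x) := by
  have hev : Pfun w =ᶠ[𝓝 x] fun y =>
      (∑ j, pd j w y * pd j w y) * w y ^ (-(2 * ((n : ℝ) - 1) / ((n : ℝ) - 2))) := by
    filter_upwards [hV.mem_nhds hx] with y hy using Pfun_eq_mul_rpow (hpos y hy)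
  have hwx : ContDiffAt ℝ (⊤ : ℕ∞) w x := hw.contDiffAt (hV.mem_nhds hx)
  have hd : DifferentiableAt ℝ w x := hwx.differentiableAt (by simp)
  have hdj : ∀ j, DifferentiableAt ℝ (pd j w) x := fun j =>
    (hwx.pd (m := 1) (WithTop.coe_le_coe.2 le_top) j).differentiableAt (by simp)
  rw [pd_congr i hev, pd_mul i (by fun_prop) (hd.rpow_const (Or.inl (hpos x hx).ne')),
    pd_rpow i _ hd (hpos x hx).ne', pd_sum i (fun j _ => (hdj j).fun_mul (hdj j))]
  congr 2
  refine Finset.sum_congr rfl fun j _ => ?_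
  rw [pd_mul i (hdj j) (hdj j)]
  ring

theorem sum_pd_pd_pd_eq_zero (hV : IsOpen V) (hw : ContDiffOn ℝ (⊤ : ℕ∞) w V)
    (hharm : ∀ x ∈ V, ∑ i, pd i (pd i w) x = 0) {x : Euc n} (hx : x ∈ V) (j : Fin n) :
    ∑ i, pd i (pd i (pd j w)) x = 0 := by
  have hsm : ∀ y ∈ V, ContDiffAt ℝ (⊤ : ℕ∞) w y := fun y hy => hw.contDiffAt (hV.mem_nhds hy)
  have h1 : ∀ i, pd i (pd i (pd j w)) x = pd j (pd i (pd i w)) x := by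
    intro i
    have hev : pd i (pd j w) =ᶠ[𝓝 x] pd j (pd i w) := by
      filter_upwards [hV.mem_nhds hx] with y hy
      exact pd_comm ((hsm y hy).of_le (WithTop.coe_le_coe.2 le_top)) i j
    rw [pd_congr i hev, pd_comm ((hsm x hx).pd (m := 2) (WithTop.coe_le_coe.2 le_top) i) i j]
  have h2 : (fun y => ∑ i, pd i (pd i w) y) =ᶠ[𝓝 x] fun _ => 0 := by
    filter_upwards [hV.mem_nhds hx] with y hy using hharm y hy
  have h3 := pd_congr j h2
  rw [pd_sum j fun i _ => (((hsm x hx).pd (m := 2) (WithTop.coe_le_coe.2 le_top) i).pd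
    (m := 1) (by norm_num) i).differentiableAt (by simp)] at h3
  simp only [h1, h3]
  simp [pd]

/-- The Bochner-type identity for the `P`-function of a positive harmonic function. -/
theorem driftLap_Pfun (hn : 3 ≤ n) (hV : IsOpen V) (hw : ContDiffOn ℝ (⊤ : ℕ∞) w V)
    (hpos : ∀ x ∈ V, 0 < w x) (hharm : ∀ x ∈ V, ∑ i, pd i (pd i w) x = 0)
    {x : Euc n} (hx : x ∈ V) :
    driftLap (fun x => (2 / w x) • gradient w x) (Pfun w) x =
      2 * w x ^ (-(2 * ((n : ℝ) - 1) / ((n : ℝ) - 2))) / w x ^ 2 *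
        ∑ i, ∑ j, conformalHess w x i j ^ 2 := by
  have hn' : (n : ℝ) - 2 ≠ 0 := by
    have : (3 : ℝ) ≤ n := by exact_mod_cast hn
    linarith
  set s : ℝ := -(2 * ((n : ℝ) - 1) / ((n : ℝ) - 2)) with hs
  have hwx : ContDiffAt ℝ (⊤ : ℕ∞) w x := hw.contDiffAt (hV.mem_nhds hx)
  have hd : DifferentiableAt ℝ w x := hwx.differentiableAt (by simp)
  have hw0 : w x ≠ 0 := (hpos x hx).ne'
  have hdj : ∀ j, DifferentiableAt ℝ (pd j w) x := fun j =>
    (hwx.pd (m := 1) (WithTop.coe_le_coe.2 le_top) j).differentiableAt (by simp)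
  have hdij : ∀ i j, DifferentiableAt ℝ (pd i (pd j w)) x := fun i j =>
    ((hwx.pd (m := 2) (WithTop.coe_le_coe.2 le_top) j).pd (m := 1) (by norm_num)
      i).differentiableAt (by simp)
  have hds : ∀ t : ℝ, DifferentiableAt ℝ (fun y => w y ^ t) x := fun t =>
    hd.rpow_const (Or.inl hw0)
  set G : ℝ := ∑ j, pd j w x * pd j w x with hG
  have hfirst : ∀ i, pd i (Pfun w) x = w x ^ s *
      (∑ j, 2 * (pd j w x * pd i (pd j w) x) + s / w x * G * pd i w x) := by
    intro i
    rw [pd_Pfun hV hw hpos hx i, ← hs, Real.rpow_sub_one hw0, ← hG]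
    field_simp
  have hsecond : ∀ i, pd i (pd i (Pfun w)) x = w x ^ s *
      (∑ j, 2 * (pd i (pd j w) x ^ 2) + ∑ j, 2 * (pd j w x * pd i (pd i (pd j w)) x) +
        2 * (s / w x) * (∑ j, 2 * (pd i w x * pd j w x * pd i (pd j w) x)) +
        s * (s - 1) / w x ^ 2 * G * (pd i w x * pd i w x) +
        s / w x * G * pd i (pd i w) x) := by
    intro i
    have hev : pd i (Pfun w) =ᶠ[𝓝 x] fun y =>
        (∑ j, 2 * (pd j w y * pd i (pd j w) y)) * w y ^ s +
          (∑ j, pd j w y * pd j w y) * (s * w y ^ (s - 1) * pd i w y) := by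
      filter_upwards [hV.mem_nhds hx] with y hy using pd_Pfun hV hw hpos hy i
    have hmul : ∀ j, DifferentiableAt ℝ (fun y => pd j w y * pd i (pd j w) y) x :=
      fun j => (hdj j).fun_mul (hdij i j)
    have hS : DifferentiableAt ℝ (fun y => ∑ j, 2 * (pd j w y * pd i (pd j w) y)) x :=
      DifferentiableAt.fun_sum fun j _ => (hmul j).const_mul 2
    have hG' : DifferentiableAt ℝ (fun y => ∑ j, pd j w y * pd j w y) x :=
      DifferentiableAt.fun_sum fun j _ => (hdj j).fun_mul (hdj j)
    have hr : DifferentiableAt ℝ (fun y => s * w y ^ (s - 1)) x := (hds _).const_mul s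
    rw [pd_congr i hev, pd_add i (hS.fun_mul (hds s)) (hG'.fun_mul (hr.fun_mul (hdj i))),
      pd_mul i hS (hds s), pd_mul i hG' (hr.fun_mul (hdj i)), pd_mul i hr (hdj i),
      pd_const_mul i s (hds _), pd_rpow i s hd hw0, pd_rpow i (s - 1) hd hw0,
      pd_sum i (fun j _ => (hmul j).const_mul 2), pd_sum i (fun j _ => (hdj j).fun_mul (hdj j)),
      ← hG]
    have h1 : ∀ j, pd i (fun y => 2 * (pd j w y * pd i (pd j w) y)) x =
        2 * (pd i (pd j w) x ^ 2) + 2 * (pd j w x * pd i (pd i (pd j w)) x) := by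
      intro j
      rw [pd_const_mul i 2 (hmul j), pd_mul i (hdj j) (hdij i j)]
      ring
    have h2 : ∀ j, pd i (fun y => pd j w y * pd j w y) x =
        2 * (pd j w x * pd i (pd j w) x) := by
      intro j
      rw [pd_mul i (hdj j) (hdj j)]
      ring
    have h3 : ∑ j, 2 * (pd i w x * pd j w x * pd i (pd j w) x) =
        pd i w x * ∑ j, 2 * (pd j w x * pd i (pd j w) x) := by
      rw [Finset.mul_sum]
      exact Finset.sum_congr rfl fun j _ => by ring
    simp only [h1, h2, h3, Finset.sum_add_distrib]
    rw [Real.rpow_sub_one hw0 (s - 1), Real.rpow_sub_one hw0 s]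
    field_simp
    ring
  have hthird : ∑ i, ∑ j, 2 * (pd j w x * pd i (pd i (pd j w)) x) = 0 := by
    rw [Finset.sum_comm]
    refine Finset.sum_eq_zero fun j _ => ?_
    rw [← Finset.mul_sum, ← Finset.mul_sum, sum_pd_pd_pd_eq_zero hV hw hharm hx j]
    simp
  set T : ℝ := ∑ i, ∑ j, pd i w x * pd j w x * pd i (pd j w) x with hT
  have hlap : ∑ i, pd i (pd i (Pfun w)) x = w x ^ s *
      (2 * ∑ i, ∑ j, pd i (pd j w) x ^ 2 + 4 * (s / w x) * T +
        s * (s - 1) / w x ^ 2 * G ^ 2) := by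
    simp only [hsecond]
    rw [← Finset.mul_sum]
    simp only [Finset.sum_add_distrib]
    rw [hthird]
    simp only [← Finset.mul_sum]
    rw [hharm x hx, ← hT, ← hG]
    ring
  have hdrift : ∑ i, ((2 / w x) • gradient w x) i * pd i (Pfun w) x = w x ^ s *
      (4 / w x * T + 2 * s / w x ^ 2 * G ^ 2) := by
    have h1 : ∀ i, ((2 / w x) • gradient w x) i * pd i (Pfun w) x = w x ^ s *
        (∑ j, 4 / w x * (pd i w x * pd j w x * pd i (pd j w) x) +
          2 * s / w x ^ 2 * G * (pd i w x * pd i w x)) := by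
      intro i
      have h3 : ∑ j, 4 / w x * (pd i w x * pd j w x * pd i (pd j w) x) =
          2 / w x * (pd i w x * ∑ j, 2 * (pd j w x * pd i (pd j w) x)) := by
        rw [Finset.mul_sum, Finset.mul_sum]
        exact Finset.sum_congr rfl fun j _ => by ring
      rw [h3, hfirst i, PiLp.smul_apply, gradient_apply, smul_eq_mul]
      field_simp
    simp only [h1]
    rw [← Finset.mul_sum]
    simp only [Finset.sum_add_distrib, ← Finset.mul_sum]
    rw [← hT, ← hG]
    ring
  rw [driftLap, hlap, hdrift]
  simp only [conformalHess]
  rw [sum_sq_of_trace_eq_zero (fun i j => pd i (pd j w) x) (fun i => pd i w x) (w x)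
    ((n : ℝ) / ((n : ℝ) - 2)) G (G / ((n : ℝ) - 2)) (hharm x hx) hG.symm, ← hT]
  have hsval : s = -(2 * ((n : ℝ) - 1) / ((n : ℝ) - 2)) := hs
  clear_value s
  generalize w x ^ s = ws
  subst hsval
  field_simp
  ring

theorem driftLap_Pfun_nonneg (hn : 3 ≤ n) (hV : IsOpen V) (hw : ContDiffOn ℝ (⊤ : ℕ∞) w V)
    (hpos : ∀ x ∈ V, 0 < w x) (hharm : ∀ x ∈ V, ∑ i, pd i (pd i w) x = 0)
    {x : Euc n} (hx : x ∈ V) :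
    0 ≤ driftLap (fun x => (2 / w x) • gradient w x) (Pfun w) x := by
  have := hpos x hx
  rw [driftLap_Pfun hn hV hw hpos hharm hx]
  positivity

theorem conformalHess_eq_zero (hn : 3 ≤ n) (hV : IsOpen V) (hw : ContDiffOn ℝ (⊤ : ℕ∞) w V)
    (hpos : ∀ x ∈ V, 0 < w x) (hharm : ∀ x ∈ V, ∑ i, pd i (pd i w) x = 0) {p : ℝ}
    (hP : ∀ x ∈ V, Pfun w x = p) {x : Euc n} (hx : x ∈ V) (i j : Fin n) :
    conformalHess w x i j = 0 := by
  have hloc : Pfun w =ᶠ[𝓝 x] fun _ => p := by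
    filter_upwards [hV.mem_nhds hx] with y hy using hP y hy
  have hpd : ∀ i, pd i (Pfun w) =ᶠ[𝓝 x] fun _ => 0 := by
    intro i
    filter_upwards [hloc.eventually_nhds] with y hy
    rw [pd_congr i hy]
    simp [pd]
  have h0 : driftLap (fun x => (2 / w x) • gradient w x) (Pfun w) x = 0 := by
    have h1 : ∀ i, pd i (Pfun w) x = 0 := fun i => (hpd i).eq_of_nhds
    have h2 : ∀ i, pd i (pd i (Pfun w)) x = 0 := by
      intro i
      rw [pd_congr i (hpd i)]
      simp [pd]
    simp [driftLap, h1, h2]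
  rw [driftLap_Pfun hn hV hw hpos hharm hx] at h0
  have hc : 2 * w x ^ (-(2 * ((n : ℝ) - 1) / ((n : ℝ) - 2))) / w x ^ 2 ≠ 0 := by
    have := hpos x hx
    positivity
  have h1 := (mul_eq_zero.1 h0).resolve_left hc
  have h2 := (Finset.sum_eq_zero_iff_of_nonneg fun i _ =>
    Finset.sum_nonneg fun j _ => sq_nonneg (conformalHess w x i j)).1 h1 i (Finset.mem_univ i)
  have h3 := (Finset.sum_eq_zero_iff_of_nonneg fun j _ =>
    sq_nonneg (conformalHess w x i j)).1 h2 j (Finset.mem_univ j)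
  exact pow_eq_zero_iff (by norm_num) |>.1 h3

theorem contDiffOn_Pfun (hV : IsOpen V) (hw : ContDiffOn ℝ (⊤ : ℕ∞) w V)
    (hpos : ∀ x ∈ V, 0 < w x) : ContDiffOn ℝ 2 (Pfun w) V := by
  have h1 : ∀ j, ContDiffOn ℝ 2 (pd j w) V := fun j => hw.pd hV (WithTop.coe_le_coe.2 le_top) j
  have h2 : ContDiffOn ℝ 2 w V := hw.of_le (WithTop.coe_le_coe.2 le_top)
  have h3 : ContDiffOn ℝ 2 (fun y =>
      (∑ j, pd j w y * pd j w y) * w y ^ (-(2 * ((n : ℝ) - 1) / ((n : ℝ) - 2)))) V :=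
    (ContDiffOn.sum fun j _ => (h1 j).mul (h1 j)).mul
      (h2.rpow_const_of_ne fun x hx => (hpos x hx).ne')
  exact h3.congr fun x hx => Pfun_eq_mul_rpow (hpos x hx)

theorem continuousOn_gradient (hV : IsOpen V) (hw : ContDiffOn ℝ (⊤ : ℕ∞) w V) :
    ContinuousOn (gradient w) V :=
  (InnerProductSpace.toDual ℝ (Euc n)).symm.continuous.comp_continuousOn
    (hw.continuousOn_fderiv_of_isOpen hV (by simp))

end PFunction

section Rigidity

variable {n : ℕ}

theorem eq_const_mul_norm_rpow_of_Pfun_eq {w : Euc n → ℝ} {V : Set (Euc n)} {A : ℝ} (hn : 3 ≤ n)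
    (hA : 0 < A) (hV : IsOpen V) (hVc : IsPreconnected V) (hV0 : V ∈ 𝓝[≠] (0 : Euc n))
    (hw : ContDiffOn ℝ (⊤ : ℕ∞) w V) (hpos : ∀ x ∈ V, 0 < w x)
    (hharm : ∀ x ∈ V, ∑ i, pd i (pd i w) x = 0)
    (hP : ∀ x ∈ V, Pfun w x = ((n : ℝ) - 2) ^ 2 * A ^ (-(2 / ((n : ℝ) - 2))))
    (htop : Tendsto w (𝓝[≠] 0) atTop) :
    ∀ x ∈ V, w x = A * ‖x‖ ^ ((2 : ℝ) - n) := by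
  have hn2 : 0 < (n : ℝ) - 2 := by
    have : (3 : ℝ) ≤ n := by exact_mod_cast hn
    linarith
  have : Nonempty (Fin n) := ⟨⟨0, by omega⟩⟩
  set p : ℝ := ((n : ℝ) - 2) ^ 2 * A ^ (-(2 / ((n : ℝ) - 2))) with hp
  have hp0 : 0 < p := by positivity
  set s : ℝ := -(n / ((n : ℝ) - 2)) with hs
  have hs1 : s - 1 = -(2 * ((n : ℝ) - 1) / ((n : ℝ) - 2)) := by
    rw [hs]; field_simp; ring
  have hs2 : s + s = -(2 * ((n : ℝ) - 1) / ((n : ℝ) - 2)) + -(2 / ((n : ℝ) - 2)) := by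
    rw [hs]; field_simp; ring
  have hsm : ∀ x ∈ V, ContDiffAt ℝ (⊤ : ℕ∞) w x := fun x hx => hw.contDiffAt (hV.mem_nhds hx)
  have hd : ∀ x ∈ V, DifferentiableAt ℝ w x := fun x hx => (hsm x hx).differentiableAt (by simp)
  have hdi : ∀ x ∈ V, ∀ i, DifferentiableAt ℝ (pd i w) x := fun x hx i =>
    ((hsm x hx).pd (m := 1) (WithTop.coe_le_coe.2 le_top) i).differentiableAt (by simp)
  have hPG : ∀ x ∈ V, (∑ k, pd k w x * pd k w x) * w x ^ (s - 1) = p := by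
    intro x hx
    rw [← hP x hx, Pfun_eq_mul_rpow (hpos x hx), hs1]
  have hsq : ∀ x ∈ V, ∑ k, (w x ^ s * pd k w x) ^ 2 = p * w x ^ (-(2 / ((n : ℝ) - 2))) := by
    intro x hx
    have h1 : ∀ k, (w x ^ s * pd k w x) ^ 2 = w x ^ (s + s) * (pd k w x * pd k w x) := by
      intro k
      rw [Real.rpow_add (hpos x hx)]
      ring
    simp only [h1]
    rw [← Finset.mul_sum, hs2, ← hs1, Real.rpow_add (hpos x hx), ← hPG x hx]
    ring
  set X : Fin n → Euc n → ℝ := fun i x => w x ^ s * pd i w x + p / ((n : ℝ) - 2) * x i with hX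
  have hproj : ∀ (i : Fin n) (x : Euc n), HasFDerivAt (fun x : Euc n => x i)
      (EuclideanSpace.proj i : Euc n →L[ℝ] ℝ) x :=
    fun i x => (EuclideanSpace.proj i : Euc n →L[ℝ] ℝ).hasFDerivAt
  have hXd : ∀ i, ∀ x ∈ V, DifferentiableAt ℝ (X i) x := fun i x hx =>
    (((hd x hx).rpow_const (Or.inl (hpos x hx).ne')).fun_mul (hdi x hx i)).fun_add
      ((hproj i x).differentiableAt.const_mul _)
  have hXpd : ∀ i j, ∀ x ∈ V, pd j (X i) x = 0 := by
    intro i j x hx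
    have hw0 := hpos x hx
    have hr : DifferentiableAt ℝ (fun y => w y ^ s) x :=
      (hd x hx).rpow_const (Or.inl hw0.ne')
    rw [hX, pd_add j (hr.fun_mul (hdi x hx i)) ((hproj i x).differentiableAt.const_mul _),
      pd_mul j hr (hdi x hx i), pd_rpow j s (hd x hx) hw0.ne',
      pd_const_mul j _ (hproj i x).differentiableAt]
    have h1 : pd j (fun x : Euc n => x i) x = if j = i then 1 else 0 := by
      rw [pd, (hproj i x).fderiv]
      simp [eq_comm]
    have h2 := conformalHess_eq_zero hn hV hw hpos hharm hP hx j i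
    rw [conformalHess] at h2
    have h3 : w x ^ s = w x ^ (s - 1) * w x := by
      rw [Real.rpow_sub_one hw0.ne']
      field_simp
    have h4 : s = -((n : ℝ) / ((n : ℝ) - 2)) := hs
    rw [h1, h3, ← hPG x hx]
    generalize w x ^ (s - 1) = c
    rw [h4]
    linear_combination c * h2
  have hXconst : ∀ i, ∃ c, ∀ x ∈ V, X i x = c := by
    intro i
    refine hV.exists_is_const_of_fderiv_eq_zero hVc
      (fun x hx => (hXd i x hx).differentiableWithinAt) fun x hx => ?_
    ext v
    rw [fderiv_eq_sum_pd]
    simp [hXpd i _ x hx]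
  have hlim0 : Tendsto (fun x => p * w x ^ (-(2 / ((n : ℝ) - 2)))) (𝓝[≠] 0) (𝓝 0) := by
    simpa using ((tendsto_rpow_neg_atTop (y := 2 / ((n : ℝ) - 2)) (by positivity)).comp
      htop).const_mul p
  have hX0 : ∀ i, ∀ x ∈ V, X i x = 0 := by
    intro i x hx
    obtain ⟨c, hc⟩ := hXconst i
    rw [hc x hx]
    have h1 : Tendsto (fun x => (w x ^ s * pd i w x) ^ 2) (𝓝[≠] 0) (𝓝 0) := by
      refine tendsto_of_tendsto_of_tendsto_of_le_of_le' tendsto_const_nhds hlim0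
        (Eventually.of_forall fun x => sq_nonneg _) ?_
      filter_upwards [hV0] with y hy
      rw [← hsq y hy]
      exact Finset.single_le_sum (f := fun k => (w y ^ s * pd k w y) ^ 2)
        (fun k _ => sq_nonneg _) (Finset.mem_univ i)
    have h2 : Tendsto (fun x => w x ^ s * pd i w x) (𝓝[≠] 0) (𝓝 0) := by
      have h3 := (Real.continuous_sqrt.tendsto 0).comp h1
      rw [Real.sqrt_zero] at h3
      refine (tendsto_zero_iff_abs_tendsto_zero _).2 (h3.congr fun x => ?_)
      simp [Real.sqrt_sq_eq_abs]
    have h4 : Tendsto (fun x : Euc n => p / ((n : ℝ) - 2) * x i) (𝓝[≠] 0) (𝓝 0) := by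
      have h5 : Tendsto (fun x : Euc n => p / ((n : ℝ) - 2) * x i) (𝓝 0)
          (𝓝 (p / ((n : ℝ) - 2) * (0 : Euc n) i)) :=
        ((hproj i 0).continuousAt.const_mul _)
      simpa using h5.mono_left nhdsWithin_le_nhds
    have h6 : Tendsto (X i) (𝓝[≠] 0) (𝓝 0) := by simpa using h2.add h4
    have h7 : Tendsto (X i) (𝓝[≠] 0) (𝓝 c) := by
      refine tendsto_const_nhds.congr' ?_
      filter_upwards [hV0] with y hy using (hc y hy).symm
    exact tendsto_nhds_unique h7 h6
  intro x hx
  have hw0 := hpos x hx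
  have h1 : ∀ k, (w x ^ s * pd k w x) ^ 2 = (p / ((n : ℝ) - 2)) ^ 2 * (x k) ^ 2 := by
    intro k
    have h2 : w x ^ s * pd k w x = -(p / ((n : ℝ) - 2) * x k) := by
      linarith [hX0 k x hx]
    rw [h2]
    ring
  have h2 := hsq x hx
  simp only [h1] at h2
  rw [← Finset.mul_sum] at h2
  have h3 : ∑ k, x k ^ 2 = ‖x‖ ^ 2 := by simp [EuclideanSpace.norm_sq_eq]
  rw [h3] at h2
  have h4 : w x ^ (-(2 / ((n : ℝ) - 2))) = A ^ (-(2 / ((n : ℝ) - 2))) * ‖x‖ ^ (2 : ℝ) := by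
    have h5 : p * (w x ^ (-(2 / ((n : ℝ) - 2)))) =
        p * (A ^ (-(2 / ((n : ℝ) - 2))) * ‖x‖ ^ (2 : ℝ)) := by
      rw [← h2, Real.rpow_two]
      have h6 : A ^ (-(2 / ((n : ℝ) - 2))) = p / ((n : ℝ) - 2) ^ 2 := by
        rw [hp]; field_simp
      rw [h6]
      field_simp
    exact mul_left_cancel₀ hp0.ne' h5
  have h5 := congrArg (fun t : ℝ => t ^ (-(((n : ℝ) - 2) / 2))) h4
  have h6 : -(2 / ((n : ℝ) - 2)) * (-(((n : ℝ) - 2) / 2)) = 1 := by field_simp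
  rw [Real.mul_rpow (by positivity) (by positivity), ← Real.rpow_mul hw0.le, ← Real.rpow_mul hA.le,
    ← Real.rpow_mul (norm_nonneg x), h6, Real.rpow_one, Real.rpow_one] at h5
  rw [h5]
  congr 2
  ring

theorem hasFDerivAt_norm_rpow_of_ne_zero {x : Euc n} (hx : x ≠ 0) (s : ℝ) :
    HasFDerivAt (fun x : Euc n => ‖x‖ ^ s) ((s * ‖x‖ ^ (s - 2)) • innerSL ℝ x) x := by
  have hx' : 0 < ‖x‖ := norm_pos_iff.2 hx
  have h := ((hasFDerivAt_id x).norm_sq).rpow_const (p := s / 2)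
    (Or.inl (by simpa using hx'.ne'))
  have heq : (fun x : Euc n => ‖x‖ ^ s) = fun x : Euc n => (‖x‖ ^ 2) ^ (s / 2) := by
    ext y
    rw [← Real.rpow_natCast, ← Real.rpow_mul (norm_nonneg y)]
    congr 1
    push_cast
    ring
  rw [heq]
  refine h.congr_fderiv ?_
  have h2 : (‖x‖ ^ 2) ^ (s / 2 - 1) = ‖x‖ ^ (s - 2) := by
    rw [← Real.rpow_natCast, ← Real.rpow_mul (norm_nonneg x)]
    congr 1
    push_cast
    ring
  ext v
  simp [h2]
  ring

theorem tendsto_norm_rpow_nhdsNE_zero {s : ℝ} (hs : 0 < s) :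
    Tendsto (fun x : Euc n => ‖x‖ ^ s) (𝓝[≠] 0) (𝓝 0) := by
  have h : ContinuousAt (fun x : Euc n => ‖x‖ ^ s) 0 :=
    continuousAt_id.norm.rpow_const (Or.inr hs.le)
  have h1 := h.tendsto.mono_left (nhdsWithin_le_nhds (s := {0}ᶜ))
  simpa [Real.zero_rpow hs.ne'] using h1

theorem tendsto_atTop_of_pole {w v : Euc n → ℝ} {A : ℝ} (hn : 3 ≤ n) (hA : 0 < A)
    (hv : ContinuousAt v 0)
    (hwv : ∀ᶠ x in 𝓝[≠] 0, w x = A * ‖x‖ ^ ((2 : ℝ) - n) + v x) :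
    Tendsto w (𝓝[≠] 0) atTop := by
  have hn2 : 0 < (n : ℝ) - 2 := by
    have : (3 : ℝ) ≤ n := by exact_mod_cast hn
    linarith
  have h1 : Tendsto (fun x : Euc n => (‖x‖ ^ ((n : ℝ) - 2))⁻¹) (𝓝[≠] 0) atTop := by
    refine Tendsto.inv_tendsto_nhdsGT_zero (tendsto_nhdsWithin_iff.2
      ⟨tendsto_norm_rpow_nhdsNE_zero hn2, ?_⟩)
    filter_upwards [self_mem_nhdsWithin] with x hx
    exact Real.rpow_pos_of_pos (norm_pos_iff.2 hx) _
  have h2 : Tendsto (fun x : Euc n => A * (‖x‖ ^ ((n : ℝ) - 2))⁻¹ + v x) (𝓝[≠] 0) atTop :=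
    (h1.const_mul_atTop hA).atTop_add (hv.tendsto.mono_left nhdsWithin_le_nhds)
  refine h2.congr' ?_
  filter_upwards [hwv] with x hx
  rw [hx, ← Real.rpow_neg (norm_nonneg x)]
  congr 3
  ring

theorem tendsto_Pfun_of_pole {w v : Euc n → ℝ} {A : ℝ} (hn : 3 ≤ n) (hA : 0 < A)
    (hv : ContDiffAt ℝ 1 v 0)
    (hwv : ∀ᶠ x in 𝓝[≠] 0, w x = A * ‖x‖ ^ ((2 : ℝ) - n) + v x) :
    Tendsto (Pfun w) (𝓝[≠] 0) (𝓝 (((n : ℝ) - 2) ^ 2 * A ^ (-(2 / ((n : ℝ) - 2))))) := by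
  have hn2 : 0 < (n : ℝ) - 2 := by
    have : (3 : ℝ) ≤ n := by exact_mod_cast hn
    linarith
  have htop := tendsto_atTop_of_pole hn hA hv.continuousAt hwv
  have hgradc : ContinuousAt (gradient v) 0 :=
    (InnerProductSpace.toDual ℝ (Euc n)).symm.continuous.continuousAt.comp
      (hv.fderiv_right (m := 0) (by simp)).continuousAt
  have hgrad : ∀ᶠ x in 𝓝[≠] (0 : Euc n),
      gradient w x = (-(((n : ℝ) - 2) * A) * ‖x‖ ^ (-(n : ℝ))) • x + gradient v x := by
    have hdv : ∀ᶠ x in 𝓝[≠] (0 : Euc n), DifferentiableAt ℝ v x :=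
      ((hv.eventually (by simp)).mono fun x hx => hx.differentiableAt (by simp)).filter_mono
        nhdsWithin_le_nhds
    have hev : ∀ᶠ x in 𝓝[≠] (0 : Euc n),
        w =ᶠ[𝓝 x] fun x => A * ‖x‖ ^ ((2 : ℝ) - n) + v x := by
      have h1 := eventually_eventually_nhdsWithin.2 hwv
      filter_upwards [h1, self_mem_nhdsWithin] with x hx hx0
      rwa [IsOpen.nhdsWithin_eq isOpen_compl_singleton hx0] at hx
    filter_upwards [hdv, hev, self_mem_nhdsWithin] with x h1 h2 h3
    refine ext_inner_right ℝ fun y => ?_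
    rw [inner_gradient_eq_fderiv, h2.fderiv_eq,
      (((hasFDerivAt_norm_rpow_of_ne_zero h3 ((2 : ℝ) - n)).const_mul A).fun_add
        h1.hasFDerivAt).fderiv,
      inner_add_left, inner_gradient_eq_fderiv, inner_smul_left]
    have h4 : (2 : ℝ) - n - 2 = -n := by ring
    simp [h4]
    ring
  have hg1 : Tendsto (fun x => ‖x‖ ^ ((n : ℝ) - 1) * ‖gradient w x‖) (𝓝[≠] 0)
      (𝓝 (((n : ℝ) - 2) * A)) := by
    have hz : Tendsto (fun x => ‖x‖ ^ ((n : ℝ) - 1) * ‖gradient v x‖) (𝓝[≠] 0) (𝓝 0) := by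
      simpa using (tendsto_norm_rpow_nhdsNE_zero (n := n) (s := (n : ℝ) - 1) (by linarith)).mul
        (hgradc.norm.tendsto.mono_left nhdsWithin_le_nhds)
    rw [tendsto_iff_norm_sub_tendsto_zero]
    refine squeeze_zero' (Eventually.of_forall fun _ => norm_nonneg _) ?_ hz
    filter_upwards [hgrad, self_mem_nhdsWithin] with x h1 h2
    have h3 : 0 < ‖x‖ := norm_pos_iff.2 h2
    have h4 : ‖x‖ ^ ((n : ℝ) - 1) * (‖x‖ ^ (-(n : ℝ)) * ‖x‖) = 1 := by
      rw [← Real.rpow_add_one h3.ne', ← Real.rpow_add h3]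
      simp
    have h5 : ‖x‖ ^ ((n : ℝ) - 1) * ‖(-(((n : ℝ) - 2) * A) * ‖x‖ ^ (-(n : ℝ))) • x‖ =
        ((n : ℝ) - 2) * A := by
      rw [norm_smul, norm_mul, norm_neg, Real.norm_of_nonneg (by positivity),
        Real.norm_of_nonneg (by positivity)]
      linear_combination (((n : ℝ) - 2) * A) * h4
    rw [← h5, ← mul_sub, norm_mul, Real.norm_of_nonneg (by positivity : 0 ≤ ‖x‖ ^ ((n : ℝ) - 1)),
      h1]
    refine mul_le_mul_of_nonneg_left ?_ (by positivity)
    refine (abs_norm_sub_norm_le _ _).trans (le_of_eq ?_)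
    congr 1
    abel
  have hg2 : Tendsto (fun x => ‖x‖ ^ ((n : ℝ) - 2) * w x) (𝓝[≠] 0) (𝓝 A) := by
    have h1 : Tendsto (fun x => A + ‖x‖ ^ ((n : ℝ) - 2) * v x) (𝓝[≠] 0) (𝓝 A) := by
      simpa using ((tendsto_norm_rpow_nhdsNE_zero (n := n) hn2).mul
        (hv.continuousAt.tendsto.mono_left nhdsWithin_le_nhds)).const_add A
    refine h1.congr' ?_
    filter_upwards [hwv, self_mem_nhdsWithin] with x h2 h3
    have h4 : ‖x‖ ^ ((n : ℝ) - 2) * ‖x‖ ^ ((2 : ℝ) - n) = 1 := by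
      rw [← Real.rpow_add (norm_pos_iff.2 h3)]
      simp
    rw [h2]
    linear_combination -A * h4
  set q : ℝ := 2 * ((n : ℝ) - 1) / ((n : ℝ) - 2) with hq
  have hlim : Tendsto (fun x => (‖x‖ ^ ((n : ℝ) - 1) * ‖gradient w x‖) ^ 2 /
      (‖x‖ ^ ((n : ℝ) - 2) * w x) ^ q) (𝓝[≠] 0) (𝓝 ((((n : ℝ) - 2) * A) ^ 2 / A ^ q)) :=
    (hg1.pow 2).div (hg2.rpow_const (Or.inl hA.ne')) (by positivity)
  have hval : (((n : ℝ) - 2) * A) ^ 2 / A ^ q =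
      ((n : ℝ) - 2) ^ 2 * A ^ (-(2 / ((n : ℝ) - 2))) := by
    have h1 : -(2 / ((n : ℝ) - 2)) = 2 - q := by rw [hq]; field_simp; ring
    rw [h1, Real.rpow_sub hA, Real.rpow_two]
    ring
  rw [← hval]
  refine hlim.congr' ?_
  filter_upwards [htop.eventually_gt_atTop 0, self_mem_nhdsWithin] with x h1 h2
  have h3 : 0 < ‖x‖ := norm_pos_iff.2 h2
  have h4 : (‖x‖ ^ ((n : ℝ) - 1)) ^ 2 = (‖x‖ ^ ((n : ℝ) - 2)) ^ q := by
    rw [← Real.rpow_natCast, ← Real.rpow_mul h3.le, ← Real.rpow_mul h3.le]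
    congr 1
    rw [hq]
    field_simp
    push_cast
    ring
  rw [Real.mul_rpow (by positivity) h1.le, mul_pow, h4, Pfun, ← hq,
    mul_div_mul_left _ _ (by positivity)]

end Rigidity

section Geometry

variable {n : ℕ}

theorem isPreconnected_ball_diff_singleton (hn : 3 ≤ n) {r : ℝ} (hr : 0 < r) :
    IsPreconnected (ball (0 : Euc n) r \ {0}) := by
  have hrank : 1 < Module.rank ℝ (Euc n) := by
    rw [← Module.finrank_eq_rank, finrank_euclideanSpace_fin]
    exact_mod_cast (by omega : 1 < n)
  have h1 := (isConnected_compl_singleton_of_one_lt_rank hrank (0 : Euc n)).isPreconnected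
  let e := OpenPartialHomeomorph.univBall (0 : Euc n) r
  have hcont : ContinuousOn e {(0 : Euc n)}ᶜ :=
    e.continuousOn.mono (by rw [OpenPartialHomeomorph.univBall_source]; exact subset_univ _)
  have h2 := h1.image e hcont
  have hinj : InjOn e univ := by
    have := e.injOn
    rwa [OpenPartialHomeomorph.univBall_source] at this
  have h3 : e '' univ = ball (0 : Euc n) r := by
    have := e.image_source_eq_target
    rwa [OpenPartialHomeomorph.univBall_source,
      OpenPartialHomeomorph.univBall_target _ hr] at this
  have h4 : e '' {(0 : Euc n)}ᶜ = ball (0 : Euc n) r \ {0} := by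
    rw [compl_eq_univ_sdiff, hinj.image_sdiff_subset (subset_univ _), h3, image_singleton,
      OpenPartialHomeomorph.univBall_apply_zero]
  rwa [h4] at h2

theorem IsPreconnected.diff_singleton_zero (hn : 3 ≤ n) {Ω : Set (Euc n)} (hΩ : IsOpen Ω)
    (hc : IsPreconnected Ω) (h0 : (0 : Euc n) ∈ Ω) : IsPreconnected (Ω \ {0}) := by
  obtain ⟨r, hr, hball⟩ := Metric.isOpen_iff.1 hΩ 0 h0
  have hB := isPreconnected_ball_diff_singleton hn hr
  have hBsub : ball (0 : Euc n) r \ {0} ⊆ Ω \ {0} := sdiff_subset_sdiff_left hball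
  have hV : IsOpen (Ω \ {(0 : Euc n)}) := hΩ.sdiff isClosed_singleton
  have key : ∀ p q : Set (Euc n), IsOpen p → IsOpen q → Ω \ {0} ⊆ p ∪ q →
      (Ω \ {0}) ∩ (p ∩ q) = ∅ → ball (0 : Euc n) r \ {0} ⊆ p → Ω \ {0} ⊆ p := by
    intro p q hp hq hpq hd hBp
    have hq0 : ∀ x ∈ ball (0 : Euc n) r \ {0}, x ∉ q := fun x hx hxq =>
      (eq_empty_iff_forall_notMem.1 hd x) ⟨hBsub hx, hBp hx, hxq⟩
    have h1 : Ω ⊆ (p ∩ (Ω \ {0}) ∪ ball 0 r) ∪ (q ∩ (Ω \ {0})) := by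
      intro x hx
      by_cases hx0 : x = 0
      · exact Or.inl (Or.inr (by rw [hx0]; exact mem_ball_self hr))
      · rcases hpq ⟨hx, hx0⟩ with h | h
        · exact Or.inl (Or.inl ⟨h, hx, hx0⟩)
        · exact Or.inr ⟨h, hx, hx0⟩
    have h2 := isPreconnected_iff_subset_of_disjoint.1 hc _ _ ((hp.inter hV).union isOpen_ball)
      (hq.inter hV) h1 (by
        rw [eq_empty_iff_forall_notMem]
        rintro x ⟨-, h3 | h3, h4⟩
        · exact eq_empty_iff_forall_notMem.1 hd x ⟨h3.2, h3.1, h4.1⟩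
        · exact hq0 x ⟨h3, h4.2.2⟩ h4.1)
    rcases h2 with h2 | h2
    · intro x hx
      rcases h2 hx.1 with h | h
      · exact h.1
      · exact hBp ⟨h, hx.2⟩
    · exact absurd rfl (h2 h0).2.2
  rw [isPreconnected_iff_subset_of_disjoint]
  intro p q hp hq hpq hd
  rcases isPreconnected_iff_subset_of_disjoint.1 hB p q hp hq (hBsub.trans hpq)
    (subset_eq_empty (inter_subset_inter_left _ hBsub) hd) with h | h
  · exact Or.inl (key p q hp hq hpq hd h)
  · exact Or.inr (key q p hq hp (by rwa [union_comm]) (by rwa [inter_comm q p]) h)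

theorem IsPreconnected.subset_of_disjoint_frontier {S Ω : Set (Euc n)} (hS : IsPreconnected S)
    (hΩ : IsOpen Ω) (hne : (S ∩ Ω).Nonempty) (hd : ∀ x ∈ S, x ∉ frontier Ω) : S ⊆ Ω := by
  refine hS.subset_left_of_subset_union hΩ isClosed_closure.isOpen_compl
    (disjoint_compl_right.mono_left subset_closure) ?_ hne
  intro x hx
  by_cases h : x ∈ closure Ω
  · left
    by_contra h1
    exact hd x hx ⟨h, by rwa [hΩ.interior_eq]⟩
  · exact Or.inr h

theorem eq_ball_of_frontier_subset_sphere {Ω : Set (Euc n)} {r : ℝ} (hr : 0 < r)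
    (hΩ : IsOpen Ω) (hb : Bornology.IsBounded Ω) (h0 : (0 : Euc n) ∈ Ω)
    (hf : frontier Ω ⊆ sphere 0 r) : Ω = ball 0 r := by
  refine Subset.antisymm ?_ ?_
  · have h1 : Ω ⊆ closedBall 0 r := by
      intro x hx
      by_contra hxr
      rw [mem_closedBall, dist_zero_right, not_le] at hxr
      have hx0 : 0 < ‖x‖ := hr.trans hxr
      obtain ⟨C, hC⟩ := hb.exists_norm_le
      let S : Set (Euc n) := (fun t : ℝ => t • x) '' Ici 1
      have hS : IsPreconnected S :=
        isPreconnected_Ici.image _ (by fun_prop)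
      have hsub : S ⊆ Ω := by
        refine hS.subset_of_disjoint_frontier hΩ ⟨x, ⟨1, mem_Ici.2 le_rfl, one_smul _ _⟩, hx⟩ ?_
        rintro _ ⟨t, ht, rfl⟩ hfr
        have h2 := hf hfr
        rw [mem_sphere, dist_zero_right, norm_smul, Real.norm_eq_abs] at h2
        have h3 : (1 : ℝ) ≤ |t| := (mem_Ici.1 ht).trans (le_abs_self t)
        nlinarith
      have hC0 : 0 ≤ C := (norm_nonneg x).trans (hC x hx)
      have h4 := hC _ (hsub ⟨1 + C / ‖x‖, mem_Ici.2 (by linarith [div_nonneg hC0 hx0.le]), rfl⟩)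
      rw [norm_smul, Real.norm_eq_abs, abs_of_nonneg (by positivity), add_mul,
        div_mul_cancel₀ _ hx0.ne'] at h4
      linarith
    have h2 := interior_mono h1
    rwa [hΩ.interior_eq, interior_closedBall _ hr.ne'] at h2
  · refine isPreconnected_ball.subset_of_disjoint_frontier hΩ ⟨0, mem_ball_self hr, h0⟩ ?_
    intro x hx hfr
    exact (mem_ball.1 hx).ne (mem_sphere.1 (hf hfr))

theorem exists_interior_ball {Ω : Set (Euc n)} {w : Euc n → ℝ} {x₀ : Euc n} {c : ℝ}
    (hΩ : IsOpen Ω) (hx₀ : x₀ ∈ frontier Ω) (hw : ContDiffAt ℝ 2 w x₀)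
    (hwc : ∀ x ∈ frontier Ω, w x = c) (hge : ∀ᶠ x in 𝓝 x₀, x ∈ Ω → c ≤ w x)
    (hg : gradient w x₀ ≠ 0) :
    ∃ R₀ > 0, ∀ R, 0 < R → R ≤ R₀ →
      ball (x₀ + (R * ‖gradient w x₀‖⁻¹) • gradient w x₀) R ⊆ Ω := by
  set g := gradient w x₀ with hgdef
  have hd0 : 0 < ‖g‖ := norm_pos_iff.2 hg
  set e : Euc n := ‖g‖⁻¹ • g with he
  have henorm : ‖e‖ = 1 := by
    rw [he, norm_smul, norm_inv, norm_norm, inv_mul_cancel₀ hd0.ne']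
  have hge' : ⟪g, e⟫_ℝ = ‖g‖ := by
    rw [he, inner_smul_right, real_inner_self_eq_norm_sq]; field_simp
  obtain ⟨K, s, hs, hK⟩ := (hw.fderiv_right (m := 1) (by norm_num)).exists_lipschitzOnWith
  have hdiff : ∀ᶠ x in 𝓝 x₀, DifferentiableAt ℝ w x := by
    filter_upwards [hw.eventually (by norm_num)] with x hx
    exact hx.differentiableAt (by norm_num)
  obtain ⟨r, hr, hrs⟩ := Metric.mem_nhds_iff.1 (inter_mem (inter_mem hs hdiff) hge)
  have hlip : ∀ x ∈ ball x₀ r, ‖fderiv ℝ w x - fderiv ℝ w x₀‖ ≤ K * ‖x - x₀‖ := by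
    intro x hx
    rw [← dist_eq_norm, ← dist_eq_norm]
    exact hK.dist_le_mul x (hrs hx).1.1 x₀ (hrs (mem_ball_self hr)).1.1
  have htaylor : ∀ x ∈ ball x₀ r, |w x - c - ⟪g, x - x₀⟫_ℝ| ≤ K * ‖x - x₀‖ ^ 2 := by
    intro x hx
    have hseg : segment ℝ x₀ x ⊆ ball x₀ r :=
      (convex_ball x₀ r).segment_subset (mem_ball_self hr) hx
    have h := (convex_segment x₀ x).norm_image_sub_le_of_norm_fderiv_le'
      (f := w) (φ := fderiv ℝ w x₀) (C := K * ‖x - x₀‖)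
      (fun z hz => (hrs (hseg hz)).1.2)
      (fun z hz => (hlip z (hseg hz)).trans (by
        have : ‖z - x₀‖ ≤ ‖x - x₀‖ := by
          obtain ⟨t, ht, rfl⟩ := (segment_eq_image_lineMap ℝ x₀ x) ▸ hz
          rw [AffineMap.lineMap_apply, vsub_eq_sub, vadd_eq_add, add_sub_cancel_right, norm_smul,
            Real.norm_eq_abs, abs_of_nonneg ht.1]
          exact mul_le_of_le_one_left (norm_nonneg _) ht.2
        gcongr))
      (left_mem_segment ℝ x₀ x) (right_mem_segment ℝ x₀ x)
    rw [hwc x₀ hx₀, ← inner_gradient_eq_fderiv, Real.norm_eq_abs] at h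
    calc _ ≤ _ := h
      _ = _ := by ring
  have hKn : (0 : ℝ) ≤ K := K.2
  set R₀ : ℝ := min (r / 4) (‖g‖ / (4 * (K + 1))) with hR₀
  have hR₀pos : 0 < R₀ := by positivity
  refine ⟨R₀, hR₀pos, fun R hR hRR => ?_⟩
  have hRr : R ≤ r / 4 := hRR.trans (min_le_left _ _)
  have hRK : R * (4 * (K + 1)) ≤ ‖g‖ := by
    rw [← le_div_iff₀ (by positivity)]; exact hRR.trans (min_le_right _ _)
  have hcenter : x₀ + (R * ‖g‖⁻¹) • g = x₀ + R • e := by rw [he, smul_smul]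
  rw [hcenter]
  have hmem : ∀ x ∈ ball (x₀ + R • e) R, x ∈ ball x₀ r := by
    intro x hx
    rw [mem_ball, dist_eq_norm] at hx ⊢
    have h1 : x - x₀ = (x - (x₀ + R • e)) + R • e := by abel
    have h2 : ‖R • e‖ = R := by rw [norm_smul, henorm, Real.norm_eq_abs, abs_of_pos hR, mul_one]
    calc ‖x - x₀‖ ≤ ‖x - (x₀ + R • e)‖ + ‖R • e‖ := by rw [h1]; exact norm_add_le _ _
      _ < r := by linarith
  have hgt : ∀ x ∈ ball (x₀ + R • e) R, c < w x := by
    intro x hx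
    have h1 := (abs_le.1 (htaylor x (hmem x hx))).1
    have h2 : ‖x - x₀ - R • e‖ ^ 2 < R ^ 2 := by
      rw [mem_ball, dist_eq_norm, ← sub_sub] at hx
      exact pow_lt_pow_left₀ hx (norm_nonneg _) (by norm_num)
    rw [norm_sub_sq_real, norm_smul, henorm, inner_smul_right, Real.norm_eq_abs, abs_of_pos hR,
      mul_one] at h2
    have h3 : ⟪g, x - x₀⟫_ℝ = ‖g‖ * ⟪x - x₀, e⟫_ℝ := by
      rw [he, inner_smul_right, real_inner_comm]; field_simp
    have h4 : ‖x - x₀‖ ^ 2 < 2 * R * ⟪x - x₀, e⟫_ℝ := by linarith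
    have h5 : 0 < ⟪x - x₀, e⟫_ℝ := by
      by_contra h
      push Not at h
      nlinarith [sq_nonneg ‖x - x₀‖]
    have h6 : 2 * R * K < ‖g‖ := by nlinarith
    nlinarith [mul_le_mul_of_nonneg_left h4.le hKn, mul_lt_mul_of_pos_right h6 h5]
  refine isPreconnected_ball.subset_of_disjoint_frontier hΩ ?_ fun x hx hfr =>
    (hgt x hx).ne' (hwc x hfr)
  have hcl : x₀ ∈ closure Ω := hx₀.1
  obtain ⟨x₁, hx₁, hdist⟩ := Metric.mem_closure_iff.1 hcl R hR
  rw [dist_comm, dist_eq_norm] at hdist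
  have hline : ∀ t ∈ Icc (0 : ℝ) R, x₁ + t • e ∈ ball x₀ (2 * R) := by
    intro t ht
    rw [mem_ball, dist_eq_norm]
    calc ‖x₁ + t • e - x₀‖ = ‖(x₁ - x₀) + t • e‖ := by congr 1; abel
      _ ≤ ‖x₁ - x₀‖ + ‖t • e‖ := norm_add_le _ _
      _ < 2 * R := by
        rw [norm_smul, henorm, Real.norm_eq_abs, abs_of_nonneg ht.1]; linarith [ht.2]
  have hb2 : ball x₀ (2 * R) ⊆ ball x₀ r := ball_subset_ball (by linarith)
  have hderiv : ∀ t ∈ Icc (0 : ℝ) R,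
      HasDerivAt (fun t : ℝ => w (x₁ + t • e)) (fderiv ℝ w (x₁ + t • e) e) t := by
    intro t ht
    have h1 : HasDerivAt (fun t : ℝ => x₁ + t • e) e t := by
      simpa using ((hasDerivAt_id t).smul_const e).const_add x₁
    exact ((hrs (hb2 (hline t ht))).1.2).hasFDerivAt.comp_hasDerivAt t h1
  have hmono : StrictMonoOn (fun t : ℝ => w (x₁ + t • e)) (Icc 0 R) := by
    refine strictMonoOn_of_deriv_pos (convex_Icc 0 R)
      (fun t ht => (hderiv t ht).continuousAt.continuousWithinAt) ?_
    intro t ht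
    rw [interior_Icc] at ht
    have ht' := Ioo_subset_Icc_self ht
    rw [(hderiv t ht').deriv]
    have h1 := hlip _ (hb2 (hline t ht'))
    have h2 := hline t ht'
    rw [mem_ball, dist_eq_norm] at h2
    have h3 := (fderiv ℝ w (x₁ + t • e) - fderiv ℝ w x₀).le_opNorm e
    rw [henorm, mul_one, _root_.sub_apply, ← inner_gradient_eq_fderiv w x₀, hge',
      Real.norm_eq_abs] at h3
    have h4 := (abs_le.1 h3).1
    nlinarith [mul_le_mul_of_nonneg_left h2.le hKn]
  have hsub : (fun t : ℝ => x₁ + t • e) '' Icc 0 R ⊆ Ω := by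
    refine (isPreconnected_Icc.image _ (by fun_prop)).subset_of_disjoint_frontier hΩ
      ⟨x₁, ⟨0, ⟨le_rfl, hR.le⟩, by simp⟩, hx₁⟩ ?_
    rintro _ ⟨t, ht, rfl⟩ hfr
    have h1 : c ≤ w x₁ := (hrs (hb2 (by simpa using hline 0 ⟨le_rfl, hR.le⟩))).2 hx₁
    rcases ht.1.eq_or_lt with h0 | h0
    · simp only [← h0, zero_smul, add_zero] at hfr
      exact hfr.2 (by rwa [hΩ.interior_eq])
    · have h2 := hmono ⟨le_rfl, hR.le⟩ ht h0
      simp only [zero_smul, add_zero] at h2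
      linarith [hwc _ hfr]
  refine ⟨x₁ + R • e, ?_, hsub ⟨R, ⟨hR.le, le_rfl⟩, rfl⟩⟩
  rw [mem_ball, dist_eq_norm]
  simpa using hdist

end Geometry

section Punctured

variable {n : ℕ} {Ω W : Set (Euc n)}

/-- The weak maximum principle on a bounded domain punctured at the origin. -/
theorem weak_maximum_principle_punctured {f : Euc n → ℝ} {b : Euc n → Euc n} {M : ℝ} (hn : 3 ≤ n)
    (hΩ : IsOpen Ω) (hc : IsPreconnected Ω) (hbdd : Bornology.IsBounded Ω) (h0 : (0 : Euc n) ∈ Ω)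
    (hf : ContDiffOn ℝ 2 f (Ω \ {0})) (hfc : ContinuousOn f (closure Ω \ {0}))
    (hb : ContinuousOn b (Ω \ {0})) (hL : ∀ x ∈ Ω \ {0}, 0 ≤ driftLap b f x)
    (hfr : ∀ x ∈ frontier Ω, f x ≤ M) (hf0 : ∀ m > M, ∀ᶠ x in 𝓝[≠] 0, f x < m) :
    ∀ x ∈ Ω \ {0}, f x ≤ M := by
  refine weak_maximum_principle (hΩ.sdiff isClosed_singleton)
    (IsPreconnected.diff_singleton_zero hn hΩ hc h0) (fun h => ?_) hf hb hL fun m hm => ?_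
  · exact ((h ▸ mem_univ (0 : Euc n)) : (0 : Euc n) ∈ Ω \ {0}).2 rfl
  · obtain ⟨ε, hε, hball⟩ := Metric.mem_nhdsWithin_iff.1 (hf0 m hm)
    have hsub : closure Ω \ ball 0 ε ⊆ closure Ω \ {0} := by
      rintro x ⟨h1, h2⟩
      exact ⟨h1, fun h3 => h2 (by rw [mem_singleton_iff.1 h3]; exact mem_ball_self hε)⟩
    refine ⟨closure Ω \ ball 0 ε, hbdd.isCompact_closure.diff isOpen_ball, hfc.mono hsub, ?_⟩
    rintro x (⟨h1, h2⟩ | ⟨h1, h2⟩)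
    · refine (hfr x ⟨h1.1, ?_⟩).trans_lt hm
      rw [hΩ.interior_eq]
      exact fun h => h2 ⟨h, (hsub h1).2⟩
    · have h3 : x ∈ ball (0 : Euc n) ε := by
        by_contra h
        exact h2 ⟨subset_closure h1.1, h⟩
      exact hball ⟨h3, h1.2⟩

theorem driftLap_neg_eq_zero {f : Euc n → ℝ} {x : Euc n} (hf : ContDiffAt ℝ 2 f x)
    (hh : ∑ i, pd i (pd i f) x = 0) : driftLap 0 (fun y => 0 + (-1) * f y) x = 0 := by
  rw [driftLap_add_const_mul (f := fun _ => (0 : ℝ)) (-1) contDiffAt_const hf]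
  have h : ∀ i : Fin n, pd i (fun _ => (0 : ℝ)) = fun _ => 0 := fun i => by
    ext y
    simp [pd]
  simp [driftLap, hh, h]

theorem le_of_harmonic_of_pole {w : Euc n → ℝ} {c : ℝ} (hn : 3 ≤ n)
    (hΩ : IsOpen Ω) (hc : IsPreconnected Ω) (hbdd : Bornology.IsBounded Ω) (h0 : (0 : Euc n) ∈ Ω)
    (hw : ContDiffOn ℝ 2 w (Ω \ {0})) (hwc : ContinuousOn w (closure Ω \ {0}))
    (hharm : ∀ x ∈ Ω \ {0}, ∑ i, pd i (pd i w) x = 0)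
    (hfr : ∀ x ∈ frontier Ω, w x = c) (htop : Tendsto w (𝓝[≠] 0) atTop) :
    ∀ x ∈ Ω \ {0}, c ≤ w x := by
  have hV : IsOpen (Ω \ {(0 : Euc n)}) := hΩ.sdiff isClosed_singleton
  intro x hx
  have h := weak_maximum_principle_punctured (f := fun y => 0 + (-1) * w y) (b := 0) (M := -c) hn
    hΩ hc hbdd h0 (contDiffOn_const.add (contDiffOn_const.mul hw))
    (continuousOn_const.add (continuousOn_const.mul hwc)) continuousOn_const
    (fun y hy => (driftLap_neg_eq_zero (hw.contDiffAt (hV.mem_nhds hy)) (hharm y hy)).ge)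
    (fun y hy => by simp [hfr y hy])
    (fun m _ => by
      filter_upwards [htop.eventually_gt_atTop (-m)] with y hy
      linarith) x hx
  linarith

theorem eq_of_harmonic_of_frontier {f : Euc n → ℝ} {c : ℝ} (hn : 3 ≤ n)
    (hΩ : IsOpen Ω) (hc : IsPreconnected Ω) (hbdd : Bornology.IsBounded Ω)
    (hf : ContDiffOn ℝ 2 f Ω) (hfc : ContinuousOn f (closure Ω))
    (hharm : ∀ x ∈ Ω, ∑ i, pd i (pd i f) x = 0)
    (hfr : ∀ x ∈ frontier Ω, f x = c) : ∀ x ∈ Ω, f x = c := by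
  have : Nonempty (Fin n) := ⟨⟨0, by omega⟩⟩
  have hu : Ω ≠ univ := fun h => NormedSpace.unbounded_univ ℝ (Euc n) (h ▸ hbdd)
  have key : ∀ x ∈ (closure Ω \ Ω) ∪ (Ω \ closure Ω), f x = c := by
    rintro x (⟨h1, h2⟩ | ⟨h1, h2⟩)
    · exact hfr x ⟨h1, by rwa [hΩ.interior_eq]⟩
    · exact absurd (subset_closure h1) h2
  intro x hx
  refine le_antisymm ?_ ?_
  · refine weak_maximum_principle (b := 0) hΩ hc hu hf continuousOn_const ?_ ?_ x hx
    · intro y hy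
      simp [driftLap, hharm y hy]
    · exact fun m hm => ⟨closure Ω, hbdd.isCompact_closure, hfc,
        fun y hy => (key y hy).trans_lt hm⟩
  · have h := weak_maximum_principle (f := fun y => 0 + (-1) * f y) (b := 0) (M := -c) hΩ hc hu
      (contDiffOn_const.add (contDiffOn_const.mul hf)) continuousOn_const
      (fun y hy => (driftLap_neg_eq_zero (hf.contDiffAt (hΩ.mem_nhds hy)) (hharm y hy)).ge)
      (fun m hm => ⟨closure Ω, hbdd.isCompact_closure,
        continuousOn_const.add (continuousOn_const.mul hfc), fun y hy => by
          rw [key y hy]; linarith⟩) x hx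
    linarith

theorem fderiv_Pfun_gradient {w : Euc n → ℝ} (hW : IsOpen W)
    (hw : ContDiffOn ℝ (⊤ : ℕ∞) w W) (hpos : ∀ x ∈ W, 0 < w x) {x : Euc n} (hx : x ∈ W) :
    fderiv ℝ (Pfun w) x (gradient w x) =
      2 * w x ^ (-(2 * ((n : ℝ) - 1) / ((n : ℝ) - 2))) *
        (hess2 w x (gradient w x) (gradient w x) -
          ((n : ℝ) - 1) / ((n : ℝ) - 2) * ‖gradient w x‖ ^ 4 / w x) := by
  have hwx : ContDiffAt ℝ 2 w x :=
    (hw.contDiffAt (hW.mem_nhds hx)).of_le (WithTop.coe_le_coe.2 le_top)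
  have h4 : ‖gradient w x‖ ^ 4 = (∑ i, pd i w x ^ 2) * ∑ i, pd i w x ^ 2 := by
    rw [← norm_gradient_sq]; ring
  rw [fderiv_eq_sum_pd, hess2_gradient hwx, h4]
  simp only [gradient_apply, pd_Pfun hW hw hpos hx]
  rw [Real.rpow_sub_one (hpos x hx).ne']
  set s : ℝ := 2 * ((n : ℝ) - 1) / ((n : ℝ) - 2) with hs
  have hs2 : ((n : ℝ) - 1) / ((n : ℝ) - 2) = s / 2 := by rw [hs]; ring
  rw [hs2]
  set G : ℝ := ∑ j, pd j w x * pd j w x with hG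
  have hG2 : ∑ i, pd i w x ^ 2 = G := by simp only [hG, sq]
  rw [hG2]
  have h1 : ∑ i, pd i w x * ((∑ j, 2 * (pd j w x * pd i (pd j w) x)) * w x ^ (-s)) =
      2 * w x ^ (-s) * ∑ i, ∑ j, pd i w x * pd j w x * pd i (pd j w) x := by
    simp only [Finset.sum_mul, Finset.mul_sum]
    refine Finset.sum_congr rfl fun i _ => Finset.sum_congr rfl fun j _ => ?_
    ring
  have h2 : ∑ i, pd i w x * (G * (-s * (w x ^ (-s) / w x) * pd i w x)) =
      G * (-s * (w x ^ (-s) / w x)) * G := by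
    conv_rhs => rw [hG, Finset.mul_sum]
    refine Finset.sum_congr rfl fun i _ => ?_
    ring
  simp only [mul_add, Finset.sum_add_distrib]
  rw [h1, h2]
  ring

theorem continuousOn_meanH {w : Euc n → ℝ} (hW : IsOpen W) (hw : ContDiffOn ℝ (⊤ : ℕ∞) w W)
    {S : Set (Euc n)} (hSW : S ⊆ W) (hS : ∀ x ∈ S, gradient w x ≠ 0) :
    ContinuousOn (meanH w) S := by
  have h1 : ∀ i, ContDiffOn ℝ 1 (pd i w) W := fun i => hw.pd hW (WithTop.coe_le_coe.2 le_top) i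
  have h2 : ∀ i j, ContinuousOn (pd i (pd j w)) S := fun i j =>
    ((h1 j).pd hW (m := 0) (by norm_num) i).continuousOn.mono hSW
  have h3 : ∀ i, ContinuousOn (pd i w) S := fun i => (h1 i).continuousOn.mono hSW
  have h4 : ContinuousOn (fun x => (∑ i, ∑ j, pd i w x * pd j w x * pd i (pd j w) x) /
      ‖gradient w x‖ ^ 3) S := by
    refine ContinuousOn.div ?_ (((continuousOn_gradient hW hw).mono hSW).norm.pow 3)
      fun x hx => pow_ne_zero 3 (norm_ne_zero_iff.2 (hS x hx))
    exact continuousOn_finsetSum _ fun i _ => continuousOn_finsetSum _ fun j _ =>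
      ((h3 i).mul (h3 j)).mul (h2 i j)
  refine h4.congr fun x hx => ?_
  rw [meanH, hess2_gradient]
  exact (hw.contDiffAt (hW.mem_nhds (hSW hx))).of_le (WithTop.coe_le_coe.2 le_top)

/-- Either the solution is the fundamental solution or the mean curvature of the boundary is
strictly below the value it takes for a ball. -/
theorem eq_fundamental_or_meanH_lt {w v : Euc n → ℝ} {A c d : ℝ} (hn : 3 ≤ n) (hA : 0 < A)
    (hc : 0 < c) (hd : 0 < d) (hΩ : IsOpen Ω) (hΩc : IsPreconnected Ω)
    (hbdd : Bornology.IsBounded Ω) (h0 : (0 : Euc n) ∈ Ω) (hW : IsOpen W)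
    (hΩW : closure Ω \ {0} ⊆ W) (hw : ContDiffOn ℝ (⊤ : ℕ∞) w W) (hpos : ∀ x ∈ W, 0 < w x)
    (hharm : ∀ x ∈ Ω \ {0}, ∑ i, pd i (pd i w) x = 0)
    (hge : ∀ x ∈ Ω \ {0}, c ≤ w x)
    (hfr : ∀ x ∈ frontier Ω, w x = c) (hgrad : ∀ x ∈ frontier Ω, ‖gradient w x‖ = d)
    (hv : ContDiffAt ℝ 1 v 0) (hwv : ∀ᶠ x in 𝓝[≠] 0, w x = A * ‖x‖ ^ ((2 : ℝ) - n) + v x)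
    (hcd : d ^ 2 / c ^ (2 * ((n : ℝ) - 1) / ((n : ℝ) - 2)) =
      ((n : ℝ) - 2) ^ 2 * A ^ (-(2 / ((n : ℝ) - 2)))) :
    (∀ x ∈ Ω \ {0}, w x = A * ‖x‖ ^ ((2 : ℝ) - n)) ∨
      ∀ x ∈ frontier Ω, meanH w x / ((n : ℝ) - 1) < d / (((n : ℝ) - 2) * c) := by
  have hn2 : 0 < (n : ℝ) - 2 := by
    have : (3 : ℝ) ≤ n := by exact_mod_cast hn
    linarith
  set V : Set (Euc n) := Ω \ {0} with hVdef
  have hV : IsOpen V := hΩ.sdiff isClosed_singleton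
  have hVc : IsPreconnected V := IsPreconnected.diff_singleton_zero hn hΩ hΩc h0
  have hVW : V ⊆ W := (sdiff_subset_sdiff_left subset_closure).trans hΩW
  have hwV := hw.mono hVW
  have hposV : ∀ x ∈ V, 0 < w x := fun x hx => hpos x (hVW hx)
  set p : ℝ := ((n : ℝ) - 2) ^ 2 * A ^ (-(2 / ((n : ℝ) - 2))) with hp
  have hfrW : frontier Ω ⊆ W := fun x hx => hΩW ⟨hx.1, fun h => hx.2 (by
    rw [hΩ.interior_eq, mem_singleton_iff.1 h]; exact h0)⟩
  have hPfr : ∀ x ∈ frontier Ω, Pfun w x = p := by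
    intro x hx
    rw [Pfun, hfr x hx, hgrad x hx, hcd]
  have hPW := contDiffOn_Pfun hW hw hpos
  have hbW : ContinuousOn (fun x => (2 / w x) • gradient w x) W :=
    (continuousOn_const.div hw.continuousOn fun x hx => (hpos x hx).ne').smul
      (continuousOn_gradient hW hw)
  have hL := fun x hx => driftLap_Pfun_nonneg hn hV hwV hposV hharm (x := x) hx
  have hlim := tendsto_Pfun_of_pole hn hA hv hwv
  have hPle : ∀ x ∈ V, Pfun w x ≤ p :=
    weak_maximum_principle_punctured hn hΩ hΩc hbdd h0 (hPW.mono hVW) (hPW.continuousOn.mono hΩW)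
      (hbW.mono hVW) hL (fun x hx => (hPfr x hx).le) fun m hm => hlim.eventually_lt_const hm
  by_cases hz : ∃ z ∈ V, Pfun w z = p
  · left
    obtain ⟨z, hzV, hz⟩ := hz
    have hconst := strong_maximum_principle hV hVc (hPW.mono hVW) (hbW.mono hVW) hL hzV
      (fun x hx => (hPle x hx).trans hz.ge)
    exact eq_const_mul_norm_rpow_of_Pfun_eq hn hA hV hVc
      (sdiff_mem_nhdsWithin_compl (hΩ.mem_nhds h0) {0}) hwV hposV hharm
      (fun x hx => (hconst x hx).trans hz) (tendsto_atTop_of_pole hn hA hv.continuousAt hwv)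
  · right
    push Not at hz
    intro x₀ hx₀
    have hx₀W := hfrW hx₀
    have hg : gradient w x₀ ≠ 0 := by
      rw [← norm_ne_zero_iff, hgrad x₀ hx₀]; exact hd.ne'
    have hx₀0 : x₀ ≠ 0 := fun h => hx₀.2 (by rw [hΩ.interior_eq, h]; exact h0)
    have hne : ∀ᶠ x in 𝓝 x₀, x ≠ 0 := isOpen_ne.mem_nhds hx₀0
    obtain ⟨R₀, hR₀, hball⟩ := exists_interior_ball hΩ hx₀
      ((hw.contDiffAt (hW.mem_nhds hx₀W)).of_le (WithTop.coe_le_coe.2 le_top)) hfr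
      (by filter_upwards [hne] with x hx hxΩ using hge x ⟨hxΩ, hx⟩) hg
    rw [hgrad x₀ hx₀] at hball
    set g := gradient w x₀ with hgdef
    have hgd : ‖g‖ = d := hgrad x₀ hx₀
    have hbc : ContinuousAt (fun x => (2 / w x) • gradient w x) x₀ :=
      hbW.continuousAt (hW.mem_nhds hx₀W)
    set B : ℝ := ‖(2 / w x₀) • gradient w x₀‖ + 1 with hB
    have hBev : ∀ᶠ x in 𝓝 x₀, ‖(2 / w x) • gradient w x‖ < B :=
      hbc.norm.eventually_lt continuousAt_const (lt_add_one _)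
    obtain ⟨r, hr, hrs⟩ := Metric.mem_nhds_iff.1 (inter_mem (inter_mem hBev hne)
      (hW.mem_nhds hx₀W))
    set R : ℝ := min R₀ (r / 3) with hR
    have hRpos : 0 < R := by positivity
    set y : Euc n := x₀ + (R * d⁻¹) • g with hy
    have hyx : ‖(R * d⁻¹) • g‖ = R := by
      rw [norm_smul, hgd, Real.norm_of_nonneg (by positivity), mul_assoc, inv_mul_cancel₀ hd.ne',
        mul_one]
    have hBΩ : ball y R ⊆ Ω := hball R hRpos (min_le_left _ _)
    have hcr : closedBall y R ⊆ ball x₀ r := by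
      intro x hx
      rw [mem_closedBall, dist_eq_norm] at hx
      rw [mem_ball, dist_eq_norm]
      have h1 : x - x₀ = (x - y) + (R * d⁻¹) • g := by rw [hy]; abel
      have h2 : R ≤ r / 3 := min_le_right _ _
      calc ‖x - x₀‖ ≤ ‖x - y‖ + ‖(R * d⁻¹) • g‖ := by rw [h1]; exact norm_add_le _ _
        _ < r := by linarith
    have hBV : ball y R ⊆ V := fun x hx =>
      ⟨hBΩ hx, (hrs (hcr (ball_subset_closedBall hx))).1.2⟩
    have hhopf := hopf_lemma (M := p) (B := B) (x₀ := x₀) hRpos (hPW.mono (hBV.trans hVW))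
      (hPW.continuousOn.mono fun x hx => (hrs (hcr hx)).2)
      (b := fun x => (2 / w x) • gradient w x)
      (fun x hx => (hrs (hcr (ball_subset_closedBall hx))).1.1.le)
      (fun x hx => hL x (hBV hx))
      (fun x hx => (hPle x (hBV hx)).lt_of_ne (hz x (hBV hx)))
      (by rw [mem_sphere, dist_comm, dist_eq_norm, hy, add_sub_cancel_left, hyx])
      (hPfr x₀ hx₀)
      ((hPW.contDiffAt (hW.mem_nhds hx₀W)).differentiableAt (by norm_num))
    have h1 : x₀ - y = (-(R * d⁻¹)) • g := by rw [hy, neg_smul]; abel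
    rw [h1, map_smul, smul_eq_mul, hgdef, fderiv_Pfun_gradient hW hw hpos hx₀W, ← hgdef, hgd,
      hfr x₀ hx₀] at hhopf
    have h2 : 0 < R * d⁻¹ := by positivity
    have h3 : 0 < 2 * c ^ (-(2 * ((n : ℝ) - 1) / ((n : ℝ) - 2))) := by positivity
    have h4 : hess2 w x₀ g g < ((n : ℝ) - 1) / ((n : ℝ) - 2) * d ^ 4 / c := by
      by_contra h
      push Not at h
      have := mul_nonneg h2.le (mul_nonneg h3.le (sub_nonneg.2 h))
      linarith
    have hn1 : 0 < (n : ℝ) - 1 := by linarith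
    rw [meanH, ← hgdef, hgd, div_div, div_lt_iff₀ (by positivity)]
    calc _ < _ := h4
      _ = _ := by field_simp

end Punctured

section Main

variable {n : ℕ}

theorem gradient_add_const_fun (u : Euc n → ℝ) (k : ℝ) :
    gradient (fun x => u x + k) = gradient u := by
  ext1 x
  simp only [gradient, fderiv_add_const]

theorem pd_add_const (u : Euc n → ℝ) (k : ℝ) (i : Fin n) :
    pd i (fun x => u x + k) = pd i u := by
  ext x
  simp only [pd, fderiv_add_const]

theorem meanH_add_const (u : Euc n → ℝ) (k : ℝ) : meanH (fun x => u x + k) = meanH u := by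
  have h : fderiv ℝ (fun x => u x + k) = fderiv ℝ u := by
    ext1 x
    rw [fderiv_add_const]
  ext x
  simp only [meanH, hess2_eq_fderiv, gradient_add_const_fun, h]

/-- A solution of the interior problem with nonvanishing boundary gradient has a genuine pole. -/
theorem pole_coeff_ne_zero {Ω U : Set (Euc n)} {u v : Euc n → ℝ} {A c : ℝ} (hn : 3 ≤ n)
    (hΩ : IsOpen Ω) (hΩc : IsPreconnected Ω) (hbdd : Bornology.IsBounded Ω)
    (h0 : (0 : Euc n) ∈ Ω) (hU : IsOpen U) (hΩU : closure Ω ⊆ U)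
    (hu : ContDiffOn ℝ (⊤ : ℕ∞) u (U \ {0})) (hfr : ∀ x ∈ frontier Ω, u x = c)
    (hv : ContDiffOn ℝ (⊤ : ℕ∞) v Ω) (hvh : ∀ x ∈ Ω, ∑ i, pd i (pd i v) x = 0)
    (huv : ∀ x ∈ Ω \ {0}, u x = A * ‖x‖ ^ ((2 : ℝ) - n) + v x)
    {x₀ : Euc n} (hx₀ : x₀ ∈ frontier Ω) (hg : gradient u x₀ ≠ 0) : A ≠ 0 := by
  intro hA
  have hx₀0 : x₀ ≠ 0 := fun h => hx₀.2 (by rw [hΩ.interior_eq, h]; exact h0)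
  have hW : IsOpen (U \ {(0 : Euc n)}) := hU.sdiff isClosed_singleton
  let f : Euc n → ℝ := Function.update u 0 (v 0)
  have hfu : ∀ x, x ≠ 0 → f x = u x := fun x hx => Function.update_of_ne hx _ _
  have hfv : ∀ x ∈ Ω, f x = v x := by
    intro x hx
    by_cases h : x = 0
    · simp [f, h]
    · rw [hfu x h, huv x ⟨hx, h⟩, hA, zero_mul, zero_add]
  have hpd : ∀ x ∈ Ω, ∀ i, pd i f x = pd i v x := fun x hx i =>
    pd_congr i (by filter_upwards [hΩ.mem_nhds hx] with y hy using hfv y hy)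
  have hfc : ContinuousOn f (closure Ω) := by
    intro x hx
    refine ContinuousAt.continuousWithinAt ?_
    by_cases h : x = 0
    · rw [h]
      refine (hv.continuousOn.continuousAt (hΩ.mem_nhds h0)).congr ?_
      filter_upwards [hΩ.mem_nhds h0] with y hy using (hfv y hy).symm
    · refine (hu.continuousOn.continuousAt (hW.mem_nhds ⟨hΩU hx, h⟩)).congr ?_
      filter_upwards [isOpen_ne.mem_nhds h] with y hy using (hfu y hy).symm
  have hconst := eq_of_harmonic_of_frontier hn hΩ hΩc hbdd
    ((hv.of_le (WithTop.coe_le_coe.2 le_top)).congr hfv) hfc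
    (fun x hx => by
      rw [← hvh x hx]
      refine Finset.sum_congr rfl fun i _ => pd_congr i ?_
      filter_upwards [hΩ.mem_nhds hx] with y hy using hpd y hy i)
    (fun x hx => by
      rw [hfu x fun h => hx.2 (by rw [hΩ.interior_eq, h]; exact h0), hfr x hx])
  have hgz : ∀ x ∈ Ω \ {0}, gradient u x = 0 := by
    intro x hx
    have hev : u =ᶠ[𝓝 x] fun _ => c := by
      filter_upwards [(hΩ.sdiff isClosed_singleton).mem_nhds hx] with y hy
      rw [← hfu y hy.2, hconst y hy.1]
    rw [gradient, hev.fderiv_eq]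
    simp
  have hgc : ContinuousAt (gradient u) x₀ :=
    (continuousOn_gradient hW hu).continuousAt (hW.mem_nhds ⟨hΩU hx₀.1, hx₀0⟩)
  obtain ⟨x, ⟨hx1, hx2⟩, hx3⟩ := mem_closure_iff_nhds.1 hx₀.1 _
    (inter_mem (hgc.eventually_ne hg) (isOpen_ne.mem_nhds hx₀0))
  exact hx1 (hgz x ⟨hx3, hx2⟩)

theorem frontier_nonempty_of_isBounded (hn : 3 ≤ n) {Ω : Set (Euc n)}
    (hbdd : Bornology.IsBounded Ω) (h0 : (0 : Euc n) ∈ Ω) : (frontier Ω).Nonempty := by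
  have : Nonempty (Fin n) := ⟨⟨0, by omega⟩⟩
  exact nonempty_frontier_iff.2 ⟨⟨0, h0⟩, fun h =>
    NormedSpace.unbounded_univ ℝ (Euc n) (h ▸ hbdd)⟩

/-- The normalized boundary value: the boundary gradient `d` and the pole coefficient
`d S / ((n - 2) σ)` determine the value `c` for which the solution on a ball is a multiple of the
fundamental solution. -/
theorem normalized_value_identities {d S σ : ℝ} (hn : 3 ≤ n) (hd : 0 < d) (hS : 0 < S)
    (hσ : 0 < σ) :
    0 < d / ((n : ℝ) - 2) * (S / σ) ^ (1 / ((n : ℝ) - 1)) ∧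
    d / (((n : ℝ) - 2) * (d / ((n : ℝ) - 2) * (S / σ) ^ (1 / ((n : ℝ) - 1)))) =
      (σ / S) ^ (1 / ((n : ℝ) - 1)) ∧
    d ^ 2 / (d / ((n : ℝ) - 2) * (S / σ) ^ (1 / ((n : ℝ) - 1))) ^
        (2 * ((n : ℝ) - 1) / ((n : ℝ) - 2)) =
      ((n : ℝ) - 2) ^ 2 * (d * S / (((n : ℝ) - 2) * σ)) ^ (-(2 / ((n : ℝ) - 2))) := by
  have hn2 : 0 < (n : ℝ) - 2 := by
    have : (3 : ℝ) ≤ n := by exact_mod_cast hn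
    linarith
  have hn1 : 0 < (n : ℝ) - 1 := by linarith
  have hq : 0 < S / σ := by positivity
  refine ⟨by positivity, ?_, ?_⟩
  · rw [← inv_div S σ, Real.inv_rpow hq.le]
    field_simp
  · set k : ℝ := d / ((n : ℝ) - 2) with hk
    have hk0 : 0 < k := by positivity
    have hdk : d = k * ((n : ℝ) - 2) := by rw [hk]; field_simp
    have hAk : d * S / (((n : ℝ) - 2) * σ) = k * (S / σ) := by rw [hk]; field_simp
    have he : 1 / ((n : ℝ) - 1) * (2 * ((n : ℝ) - 1) / ((n : ℝ) - 2)) = 2 / ((n : ℝ) - 2) := by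
      field_simp
    have he2 : 2 * ((n : ℝ) - 1) / ((n : ℝ) - 2) = 2 + 2 / ((n : ℝ) - 2) := by
      field_simp; ring
    rw [hAk, Real.mul_rpow hk0.le (by positivity), ← Real.rpow_mul hq.le, he, he2,
      Real.mul_rpow hk0.le hq.le, Real.rpow_add hk0, Real.rpow_neg hk0.le, Real.rpow_neg hq.le,
      Real.rpow_two, hdk]
    have h1 : 0 < k ^ (2 / ((n : ℝ) - 2)) := by positivity
    have h2 : 0 < (S / σ) ^ (2 / ((n : ℝ) - 2)) := by positivity
    field_simp

end Main

/-- constant Neumann data on `∂Ω` for the interior problem, plus a condition on the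
supremum of the mean curvature, implies rotational symmetry. -/
theorem interior_constant_gradient_overdetermined_symmetry
    (n : ℕ) (hn : 3 ≤ n) (Ω : Set (EuclideanSpace ℝ (Fin n)))
    (u : EuclideanSpace ℝ (Fin n) → ℝ) (d c : ℝ) (hd : 0 < d)
    (hΩ : GoodDomain Ω) (hu : InteriorSol Ω d c u)
    (hgrad : ∀ x ∈ frontier Ω, ‖gradient u x‖ = d)
    (hsup : sSup ((fun x => meanH u x / ((n : ℝ) - 1)) '' frontier Ω) ≥
      (sphereArea n / sArea (frontier Ω)) ^ (1 / ((n : ℝ) - 1))) :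
    ∃ r₀ : ℝ, 0 < r₀ ∧ Ω = Metric.ball (0 : EuclideanSpace ℝ (Fin n)) r₀ ∧
      ∀ x ∈ Ω \ {(0 : EuclideanSpace ℝ (Fin n))},
        u x = c + d * sArea (frontier Ω) / (((n : ℝ) - 2) * sphereArea n) *
          (‖x‖ ^ ((2 : ℝ) - n) - r₀ ^ ((2 : ℝ) - n)) := by
  obtain ⟨hΩo, hΩconn, hbdd, h0⟩ := hΩ
  obtain ⟨⟨U, hU, hΩU, hus⟩, hlap, hfr, v, hv, hvlap, huv⟩ := hu
  have hΩc := hΩconn.isPreconnected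
  have hn2 : 0 < (n : ℝ) - 2 := by
    have : (3 : ℝ) ≤ n := by exact_mod_cast hn
    linarith
  have hW : IsOpen (U \ {(0 : Euc n)}) := hU.sdiff isClosed_singleton
  have hVo : IsOpen (Ω \ {(0 : Euc n)}) := hΩo.sdiff isClosed_singleton
  have hVU : closure Ω \ {(0 : Euc n)} ⊆ U \ {0} := sdiff_subset_sdiff_left hΩU
  have hVcl : Ω \ {(0 : Euc n)} ⊆ closure Ω \ {0} := sdiff_subset_sdiff_left subset_closure
  have hfr0 : ∀ x ∈ frontier Ω, x ≠ 0 := fun x hx h =>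
    hx.2 (by rw [hΩo.interior_eq, h]; exact h0)
  have hsmooth : ∀ x ∈ Ω \ {(0 : Euc n)}, ContDiffAt ℝ 2 u x := fun x hx =>
    (hus.contDiffAt (hW.mem_nhds (hVU (hVcl hx)))).of_le (WithTop.coe_le_coe.2 le_top)
  have hharm : ∀ x ∈ Ω \ {(0 : Euc n)}, ∑ i, pd i (pd i u) x = 0 := fun x hx => by
    rw [← lap_eq_sum_pd (hsmooth x hx), hlap x hx]
  have hvharm : ∀ x ∈ Ω, ∑ i, pd i (pd i v) x = 0 := fun x hx => by
    rw [← lap_eq_sum_pd ((hv.contDiffAt (hΩo.mem_nhds hx)).of_le (WithTop.coe_le_coe.2 le_top)),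
      hvlap x hx]
  obtain ⟨z, hz⟩ := frontier_nonempty_of_isBounded hn hbdd h0
  have hgne : ∀ x ∈ frontier Ω, gradient u x ≠ 0 := fun x hx => by
    rw [← norm_ne_zero_iff, hgrad x hx]; exact hd.ne'
  set S : ℝ := sArea (frontier Ω) with hSdef
  set σ : ℝ := sphereArea n with hσdef
  set A : ℝ := d * S / (((n : ℝ) - 2) * σ) with hAdef
  have hA0 : A ≠ 0 := pole_coeff_ne_zero hn hΩo hΩc hbdd h0 hU hΩU hus hfr hv hvharm huv hz
    (hgne z hz)
  have hS0 : 0 ≤ S := ENNReal.toReal_nonneg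
  have hσ0 : 0 ≤ σ := ENNReal.toReal_nonneg
  have hS : 0 < S := hS0.lt_of_ne fun h => hA0 (by rw [hAdef, ← h]; simp)
  have hσ : 0 < σ := hσ0.lt_of_ne fun h => hA0 (by rw [hAdef, ← h]; simp)
  have hA : 0 < A := by positivity
  obtain ⟨hk, hk1, hk2⟩ := normalized_value_identities hn hd hS hσ
  set k : ℝ := d / ((n : ℝ) - 2) * (S / σ) ^ (1 / ((n : ℝ) - 1)) with hkdef
  let w : Euc n → ℝ := fun x => u x + (k - c)
  have hwsm : ContDiffOn ℝ (⊤ : ℕ∞) w (U \ {0}) := hus.add contDiffOn_const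
  have hwfr : ∀ x ∈ frontier Ω, w x = k := fun x hx => by
    simp only [w, hfr x hx, add_sub_cancel]
  have hwharm : ∀ x ∈ Ω \ {(0 : Euc n)}, ∑ i, pd i (pd i w) x = 0 := fun x hx => by
    simp only [w, pd_add_const, hharm x hx]
  have hv1 : ContDiffAt ℝ 1 (fun x => v x + (k - c)) 0 :=
    ((hv.contDiffAt (hΩo.mem_nhds h0)).of_le (WithTop.coe_le_coe.2 le_top)).add contDiffAt_const
  have hwv : ∀ᶠ x in 𝓝[≠] (0 : Euc n), w x = A * ‖x‖ ^ ((2 : ℝ) - n) + (v x + (k - c)) := by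
    filter_upwards [sdiff_mem_nhdsWithin_compl (hΩo.mem_nhds h0) {0}] with x hx
    simp only [w, huv x hx]
    ring
  have hge : ∀ x ∈ Ω \ {(0 : Euc n)}, k ≤ w x :=
    le_of_harmonic_of_pole hn hΩo hΩc hbdd h0
      ((hwsm.mono (hVcl.trans hVU)).of_le (WithTop.coe_le_coe.2 le_top))
      (hwsm.continuousOn.mono hVU) hwharm hwfr (tendsto_atTop_of_pole hn hA hv1.continuousAt hwv)
  have hWpos : IsOpen {x ∈ U \ {(0 : Euc n)} | 0 < w x} :=
    hwsm.continuousOn.isOpen_inter_preimage hW isOpen_Ioi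
  have hclW : closure Ω \ {(0 : Euc n)} ⊆ {x ∈ U \ {(0 : Euc n)} | 0 < w x} := by
    intro x hx
    refine ⟨hVU hx, hk.trans_le ?_⟩
    by_cases h : x ∈ Ω
    · exact hge x ⟨h, hx.2⟩
    · exact (hwfr x ⟨hx.1, by rwa [hΩo.interior_eq]⟩).ge
  rcases eq_fundamental_or_meanH_lt hn hA hk hd hΩo hΩc hbdd h0 hWpos hclW
    (hwsm.mono fun x hx => hx.1) (fun x hx => hx.2) hwharm hge hwfr
    (by simpa only [w, gradient_add_const_fun] using hgrad) hv1 hwv hk2 with h | h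
  · have hcl : ∀ x ∈ frontier Ω, k = A * ‖x‖ ^ ((2 : ℝ) - n) := by
      intro x hx
      have hx0 := hfr0 x hx
      have hxcl : x ∈ closure (Ω \ {(0 : Euc n)}) := by
        rw [mem_closure_iff_nhds]
        intro t ht
        obtain ⟨y, ⟨hy1, hy2⟩, hy3⟩ := mem_closure_iff_nhds.1 hx.1 _
          (inter_mem ht (isOpen_ne.mem_nhds hx0))
        exact ⟨y, hy1, hy3, hy2⟩
      have : (𝓝[Ω \ {(0 : Euc n)}] x).NeBot := mem_closure_iff_nhdsWithin_neBot.1 hxcl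
      have h1 : Tendsto w (𝓝[Ω \ {(0 : Euc n)}] x) (𝓝 (w x)) :=
        (hwsm.continuousOn.continuousAt (hW.mem_nhds (hVU ⟨hx.1, hx0⟩))).tendsto.mono_left
          nhdsWithin_le_nhds
      have h2 : Tendsto (fun y : Euc n => A * ‖y‖ ^ ((2 : ℝ) - n)) (𝓝[Ω \ {(0 : Euc n)}] x)
          (𝓝 (A * ‖x‖ ^ ((2 : ℝ) - n))) :=
        ((hasFDerivAt_norm_rpow_of_ne_zero hx0 _).continuousAt.tendsto.const_mul A).mono_left
          nhdsWithin_le_nhds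
      rw [← hwfr x hx]
      refine tendsto_nhds_unique h1 (h2.congr' ?_)
      filter_upwards [self_mem_nhdsWithin] with y hy using (h y hy).symm
    have hz0 : 0 < ‖z‖ := norm_pos_iff.2 (hfr0 z hz)
    refine ⟨‖z‖, hz0, ?_, ?_⟩
    · refine eq_ball_of_frontier_subset_sphere hz0 hΩo hbdd h0 fun x hx => ?_
      rw [mem_sphere, dist_zero_right]
      have h1 : ‖x‖ ^ ((2 : ℝ) - n) = ‖z‖ ^ ((2 : ℝ) - n) :=
        mul_left_cancel₀ hA0 ((hcl x hx).symm.trans (hcl z hz))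
      exact (Real.rpow_left_inj (norm_nonneg x) (norm_nonneg z) (by linarith)).1 h1
    · intro x hx
      have h1 := h x hx
      have h2 := hcl z hz
      simp only [w] at h1
      linear_combination h1 - h2
  · exfalso
    have hcompact : IsCompact (frontier Ω) :=
      hbdd.isCompact_closure.of_isClosed_subset isClosed_frontier frontier_subset_closure
    have hcont : ContinuousOn (fun x => meanH u x / ((n : ℝ) - 1)) (frontier Ω) :=
      (continuousOn_meanH hW hus (fun x hx => hVU ⟨hx.1, hfr0 x hx⟩) hgne).div_const _
    obtain ⟨x, hx, hxs⟩ := hcompact.exists_sSup_image_eq ⟨z, hz⟩ hcont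
    have h1 := h x hx
    simp only [w, meanH_add_const] at h1
    rw [hk1] at h1
    rw [hxs] at hsup
    exact absurd hsup (not_le.2 h1)
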